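/- arXiv:2302.00323 — 6 statements merged into one kernel-verified Lean document; each statement's English description precedes it below -/
import Mathlib

section
/- Fix integers n ≥ 2 and m ≥ 1 and a real number α with 0 < α < 1 and m ≥ ⌈1/α⌉. For every v ∈ V(α;m) the following lower bounds on the MinMaxShare hold: (i) if α > 1/n then MMS_n(v) ≥ α; (ii) if α ≤ 1/n then MMS_n(v) ≥ 1/n; (iii) moreover, if k ≥ 1 is an integer with 1/((k+1)n) < α < 1/(kn) and m ≤ kn + n − 1, then MMS_n(v) ≥ kα + (1 − knα)/(m − kn). -/
open Finset

/-- A (normalised, additive) disutility function on `m` objects. -/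
def IsDisutility (m : ℕ) (v : Fin m → ℝ) : Prop :=
  (∀ e, 0 ≤ v e) ∧ ∑ e, v e = 1

/-- The MinMaxShare of `v` among `n` agents: the minimum over allocations
`A : Fin m → Fin n` of the maximum bundle disutility. -/
noncomputable def MMS (n m : ℕ) (v : Fin m → ℝ) : ℝ :=
  ⨅ A : Fin m → Fin n, ⨆ j : Fin n, ∑ e ∈ Finset.univ.filter (fun e => A e = j), v e

/-- `v ∈ V(α;m)`: a disutility function on `m` objects whose maximum single-object
value equals `α`. -/
def Vmem (α : ℝ) (m : ℕ) (v : Fin m → ℝ) : Prop :=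
  IsDisutility m v ∧ (⨆ e, v e) = α

/-- A number bounded by some bundle of every allocation bounds the MinMaxShare from below. -/
lemma le_MMS {n m : ℕ} (hn : 0 < n) {v : Fin m → ℝ} {c : ℝ}
    (h : ∀ A : Fin m → Fin n, ∃ j, c ≤ ∑ e ∈ Finset.univ.filter (fun e => A e = j), v e) :
    c ≤ MMS n m v := by
  have : Nonempty (Fin n) := ⟨⟨0, hn⟩⟩
  refine le_ciInf fun A => ?_
  obtain ⟨j, hj⟩ := h A
  exact hj.trans (le_ciSup (f := fun j => ∑ e ∈ Finset.univ.filter (fun e => A e = j), v e)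
    (Set.finite_range _).bddAbove j)

/-- Every single object is worth at most the MinMaxShare. -/
lemma apply_le_MMS {n m : ℕ} (hn : 0 < n) {v : Fin m → ℝ} (hv : ∀ e, 0 ≤ v e) (e : Fin m) :
    v e ≤ MMS n m v :=
  le_MMS hn fun A => ⟨A e, Finset.single_le_sum (fun i _ => hv i) (by simp)⟩

/-- The proportional share is at most the MinMaxShare. -/
lemma one_div_le_MMS {n m : ℕ} (hn : 0 < n) {v : Fin m → ℝ} (hv : ∑ e, v e = 1) :
    1 / (n : ℝ) ≤ MMS n m v := by
  refine le_MMS hn fun A => ?_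
  by_contra! h
  have : Nonempty (Fin n) := ⟨⟨0, hn⟩⟩
  have hlt := Finset.sum_lt_sum_of_nonempty Finset.univ_nonempty fun j _ => h j
  rw [Finset.sum_fiberwise, hv] at hlt
  have : (n : ℝ) ≠ 0 := by positivity
  simp [this] at hlt

/-- If all objects are worth at most `α`, and there are more than `k * n` of them, then some
bundle is worth at least `k * α + x`, where `x ≤ α` is the average of what remains of the total
value `1` after removing `k * n` objects of value `α`. -/
lemma add_le_MMS {n m k : ℕ} (hn : 0 < n) {v : Fin m → ℝ} {α x : ℝ}
    (hle : ∀ e, v e ≤ α) (hv : ∑ e, v e = 1) (hkm : k * n < m) (hx0 : 0 ≤ x) (hxα : x ≤ α)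
    (hx : ((m : ℝ) - k * n) * x = 1 - k * n * α) :
    k * α + x ≤ MMS n m v := by
  refine le_MMS hn fun A => ?_
  by_contra! h
  set N : Fin n → ℕ := fun j => (Finset.univ.filter (fun e => A e = j)).card with hN
  have hNsum : ∑ j, N j = m := by
    have := Finset.card_eq_sum_card_fiberwise (f := A) (s := Finset.univ) (t := Finset.univ)
      (by simp)
    simpa [hN] using this.symm
  have hbig (j : Fin n) (hj : k < N j) :
      ∑ e ∈ Finset.univ.filter (fun e => A e = j), v e < k * α + ((N j : ℝ) - k) * x := by
    have hj' : (k : ℝ) + 1 ≤ N j := by exact_mod_cast hj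
    nlinarith [h j]
  have hall (j : Fin n) :
      ∑ e ∈ Finset.univ.filter (fun e => A e = j), v e ≤ k * α + ((N j : ℝ) - k) * x := by
    rcases lt_or_ge k (N j) with hj | hj
    · exact (hbig j hj).le
    · have hsum : ∑ e ∈ Finset.univ.filter (fun e => A e = j), v e ≤ N j * α := by
        simpa [hN] using Finset.sum_le_card_nsmul _ v α fun e _ => hle e
      have hj' : (N j : ℝ) ≤ k := by exact_mod_cast hj
      nlinarith
  obtain ⟨j, hj⟩ : ∃ j, k < N j := by
    by_contra! hsmall
    have := Finset.sum_le_sum fun j (_ : j ∈ Finset.univ) => hsmall j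
    simp only [hNsum, Finset.sum_const, Finset.card_univ, Fintype.card_fin, smul_eq_mul] at this
    lia
  have hlt := Finset.sum_lt_sum (fun j _ => hall j) ⟨j, Finset.mem_univ j, hbig j hj⟩
  have hNsum' : ∑ j, (N j : ℝ) = m := by exact_mod_cast hNsum
  rw [Finset.sum_fiberwise, hv, Finset.sum_add_distrib, ← Finset.sum_mul (f := fun j => (N j : ℝ) - k),
    Finset.sum_sub_distrib, hNsum'] at hlt
  simp only [Finset.sum_const, Finset.card_univ, Fintype.card_fin, nsmul_eq_mul] at hlt
  linarith

theorem stmt0 (n m : ℕ) (hn : 2 ≤ n) (hm : 1 ≤ m) (α : ℝ) (hα0 : 0 < α) (hα1 : α < 1)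
    (hmα : ⌈1/α⌉ ≤ (m : ℤ)) (v : Fin m → ℝ) (hv : Vmem α m v) :
    (1/(n:ℝ) < α → α ≤ MMS n m v) ∧
    (α ≤ 1/(n:ℝ) → 1/(n:ℝ) ≤ MMS n m v) ∧
    (∀ k : ℕ, 1 ≤ k → 1/(((k:ℝ)+1)*(n:ℝ)) < α → α < 1/((k:ℝ)*(n:ℝ)) →
      (m : ℤ) ≤ (k:ℤ)*n + n - 1 →
      (k:ℝ)*α + (1 - (k:ℝ)*(n:ℝ)*α)/((m:ℝ) - (k:ℝ)*(n:ℝ)) ≤ MMS n m v) := by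
  obtain ⟨⟨hnonneg, hsum⟩, hsup⟩ := hv
  have hn0 : 0 < n := by lia
  have : Nonempty (Fin m) := ⟨⟨0, hm⟩⟩
  have hle (e : Fin m) : v e ≤ α := hsup ▸ le_ciSup (Set.finite_range v).bddAbove e
  refine ⟨fun _ => hsup ▸ ciSup_le fun e => apply_le_MMS hn0 hnonneg e,
    fun _ => one_div_le_MMS hn0 hsum, fun k hk _ hαk _ => ?_⟩
  have hkn : (0 : ℝ) < k * n := by positivity
  have hpos : k * n * α < 1 := by rwa [lt_div_iff₀ hkn, mul_comm] at hαk
  have hmα' : 1 ≤ m * α := by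
    have h : 1 / α ≤ m := by exact_mod_cast Int.ceil_le.mp hmα
    rwa [div_le_iff₀ hα0] at h
  have hkm : (k : ℝ) * n < m := lt_of_mul_lt_mul_right (hpos.trans_le hmα') hα0.le
  have hr : (0 : ℝ) < m - k * n := sub_pos.mpr hkm
  refine add_le_MMS hn0 hle hsum (by exact_mod_cast hkm)
    (div_nonneg (by linarith) hr.le) ?_ (mul_div_cancel₀ _ hr.ne')
  rw [div_le_iff₀ hr]
  linarith
end

section
/- Let n ≥ 2 and k ≥ 0 be integers, not simultaneously n = 2 and k = 1, let α ∈ D(n,k), and let m ≥ kn + n + 1. Then for every v ∈ V(α;m), MMS_n(v) ≤ ((k+2)/(k+1))·(1−α)/n. -/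
open Finset

/-- The objects in `S` can be distributed over `p` bundles, each of total weight at most `B`. -/
def Packable {ι : Type*} (x : ι → ℝ) (B : ℝ) (p : ℕ) (S : Finset ι) : Prop :=
  ∃ A : ι → ℕ, (∀ i ∈ S, A i < p) ∧ ∀ j < p, ∑ i ∈ S with A i = j, x i ≤ B

section Packable

variable {ι : Type*} {x : ι → ℝ} {B : ℝ} {p q : ℕ} {S T : Finset ι}

lemma Packable.union [DecidableEq ι] (hS : Packable x B p S) (hT : Packable x B q T)
    (h : Disjoint S T) :
    Packable x B (p + q) (S ∪ T) := by
  obtain ⟨A, hA, hAB⟩ := hS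
  obtain ⟨C, hC, hCB⟩ := hT
  have hnot : ∀ i ∈ T, i ∉ S := fun i hi hi' => Finset.disjoint_left.mp h hi' hi
  refine ⟨fun i => if i ∈ S then A i else p + C i, ?_, ?_⟩
  · intro i hi
    by_cases hiS : i ∈ S
    · have := hA i hiS
      simp only [hiS, if_true]
      omega
    · have := hC i ((Finset.mem_union.mp hi).resolve_left hiS)
      simp only [hiS, if_false]
      omega
  · intro j hj
    rw [Finset.sum_filter, Finset.sum_union h]
    have e1 : ∑ i ∈ S, (if (if i ∈ S then A i else p + C i) = j then x i else 0)
        = ∑ i ∈ S, if A i = j then x i else 0 :=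
      Finset.sum_congr rfl fun i hi => by simp [hi]
    have e2 : ∑ i ∈ T, (if (if i ∈ S then A i else p + C i) = j then x i else 0)
        = ∑ i ∈ T, if p + C i = j then x i else 0 :=
      Finset.sum_congr rfl fun i hi => by simp [hnot i hi]
    rw [e1, e2]
    rcases lt_or_ge j p with hjp | hjp
    · have e3 : ∑ i ∈ T, (if p + C i = j then x i else 0) = 0 :=
        Finset.sum_eq_zero fun i _ => if_neg (by omega)
      rw [e3, add_zero, ← Finset.sum_filter]
      exact hAB j hjp
    · have e3 : ∑ i ∈ S, (if A i = j then x i else 0) = 0 :=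
        Finset.sum_eq_zero fun i hi => if_neg (by have := hA i hi; omega)
      have e4 : ∑ i ∈ T, (if p + C i = j then x i else 0)
          = ∑ i ∈ T, if C i = j - p then x i else 0 :=
        Finset.sum_congr rfl fun i _ => by congr 1; exact propext (by omega)
      rw [e3, zero_add, e4, ← Finset.sum_filter]
      exact hCB (j - p) (by omega)

lemma packable_one (h : ∑ i ∈ S, x i ≤ B) : Packable x B 1 S := by
  refine ⟨fun _ => 0, fun _ _ => one_pos, fun j hj => ?_⟩
  obtain rfl : j = 0 := by omega
  simpa using h

lemma packable_empty (hB : 0 ≤ B) : Packable x B p ∅ :=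
  ⟨fun _ => 0, by simp, by simpa using fun _ _ => hB⟩

/-- Greedy step: an object fits into the least loaded bundle. -/
lemma Packable.insert [DecidableEq ι] {a : ι} (hS : Packable x B p S) (ha : a ∉ S) (hp : 0 < p)
    (h : ∑ i ∈ S, x i ≤ p * (B - x a)) : Packable x B p (insert a S) := by
  obtain ⟨A, hA, hAB⟩ := hS
  have hex : ∃ j ∈ Finset.range p, ∑ i ∈ S with A i = j, x i ≤ B - x a := by
    apply Finset.exists_le_of_sum_le (Finset.nonempty_range_iff.mpr hp.ne')
    rw [Finset.sum_fiberwise_of_maps_to (fun i hi => Finset.mem_range.mpr (hA i hi))]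
    rwa [Finset.sum_const, Finset.card_range, nsmul_eq_mul]
  obtain ⟨l, hl, hlB⟩ := hex
  rw [Finset.mem_range] at hl
  refine ⟨Function.update A a l, ?_, ?_⟩
  · intro i hi
    rcases eq_or_ne i a with rfl | hia
    · simpa using hl
    · rw [Function.update_of_ne hia]
      exact hA i (Finset.mem_of_mem_insert_of_ne hi hia)
  · intro j hj
    rw [Finset.sum_filter, Finset.sum_insert ha]
    have e : ∑ i ∈ S, (if Function.update A a l i = j then x i else 0)
        = ∑ i ∈ S with A i = j, x i := by
      rw [Finset.sum_filter]
      refine Finset.sum_congr rfl fun i hi => ?_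
      rw [Function.update_of_ne (ne_of_mem_of_not_mem hi ha)]
    rw [e, Function.update_self]
    split_ifs with hlj
    · subst hlj
      linarith
    · linarith [hAB j hj]

/-- Objects of weight at most `b` and total weight at most `(p + 1) b` fit into `p` bundles
of capacity `2 b`. -/
lemma packable_of_small [DecidableEq ι] {b : ℝ} (hb : 0 ≤ b) (hx : ∀ i, 0 ≤ x i) (hp : 0 < p)
    (hS : ∀ i ∈ S, x i ≤ b) (hsum : ∑ i ∈ S, x i ≤ (p + 1) * b) :
    Packable x (2 * b) p S := by
  induction S using Finset.induction_on with
  | empty => exact packable_empty (by positivity)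
  | insert a S ha ih =>
    rw [Finset.sum_insert ha] at hsum
    have hp' : (1 : ℝ) ≤ p := by exact_mod_cast hp
    refine (ih (fun i hi => hS i (Finset.mem_insert_of_mem hi))
      (by linarith [hx a])).insert ha hp ?_
    have := hS a (Finset.mem_insert_self a S)
    nlinarith

/-- Objects of weight at most `2 b` and total weight at most `(p + 1) b` fit into `p` bundles
of capacity `2 b`. -/
lemma packable_two_mul [DecidableEq ι] {b : ℝ} (hb : 0 ≤ b) (hx : ∀ i, 0 ≤ x i) (hp : 0 < p)
    (hS : ∀ i ∈ S, x i ≤ 2 * b) (hsum : ∑ i ∈ S, x i ≤ (p + 1) * b) :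
    Packable x (2 * b) p S := by
  induction p, hp using Nat.le_induction generalizing S with
  | base => exact packable_one (by norm_num at hsum; linarith)
  | succ p hp ih =>
    by_cases h : ∃ a ∈ S, b ≤ x a
    · obtain ⟨a, ha, hab⟩ := h
      have e := Finset.add_sum_erase S x ha
      have h1 : Packable x (2 * b) p (S.erase a) := by
        refine ih (fun i hi => hS i (Finset.mem_of_mem_erase hi)) ?_
        push_cast at hsum
        linarith
      have h2 : Packable x (2 * b) 1 {a} := packable_one (by simpa using hS a ha)
      have h3 := h1.union h2 (by simp)
      rwa [Finset.union_comm, ← Finset.insert_eq, Finset.insert_erase ha] at h3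
    · push Not at h
      exact packable_of_small hb hx (Nat.succ_pos p) (fun i hi => (h i hi).le) hsum

end Packable

section Sequences

variable {x : ℕ → ℝ} {B : ℝ}

lemma packable_blocks {a : ℝ} {c : ℕ} (hx : ∀ i, x i ≤ a) (hB : c * a ≤ B) (hB0 : 0 ≤ B)
    (p : ℕ) : Packable x B p (Finset.range (p * c)) := by
  induction p with
  | zero => simpa using packable_empty hB0
  | succ p ih =>
    have h1 : Packable x B 1 (Finset.Ico (p * c) ((p + 1) * c)) := by
      refine packable_one (le_trans (Finset.sum_le_card_nsmul _ _ a fun i _ => hx i) ?_)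
      rw [Nat.card_Ico, add_mul, one_mul, Nat.add_sub_cancel_left, nsmul_eq_mul]
      exact hB
    have h2 := ih.union h1 (by
      rw [Finset.range_eq_Ico]; exact Finset.Ico_disjoint_Ico_consecutive _ _ _)
    rwa [Finset.range_eq_Ico, Finset.Ico_union_Ico_eq_Ico (Nat.zero_le _)
      (Nat.mul_le_mul_right c (Nat.le_succ p)), ← Finset.range_eq_Ico] at h2

/-- Splitting `2 t` consecutive terms of an antitone sequence by the parity of their position. -/
lemma packable_alternating (hx : Antitone x) (a t : ℕ) (ht : 0 < t)
    (hB : ∑ i ∈ Finset.Ico a (a + 2 * t), x i + x a - x (a + 2 * t - 1) ≤ 2 * B) :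
    Packable x B 2 (Finset.Ico a (a + 2 * t)) := by
  have key : ∀ t, ∑ i ∈ Finset.Ico a (a + 2 * t), x i
      = ∑ i ∈ Finset.range t, x (a + 2 * i) + ∑ i ∈ Finset.range t, x (a + 2 * i + 1) := by
    intro t
    induction t with
    | zero => simp
    | succ t ih =>
      rw [show a + 2 * (t + 1) = a + 2 * t + 1 + 1 by ring,
        Finset.sum_Ico_succ_top (by omega), Finset.sum_Ico_succ_top (by omega), ih,
        Finset.sum_range_succ, Finset.sum_range_succ]
      ring
  have hdiff : ∀ t, ∑ i ∈ Finset.range (t + 1), x (a + 2 * i)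
      - ∑ i ∈ Finset.range (t + 1), x (a + 2 * i + 1) ≤ x a - x (a + 2 * (t + 1) - 1) := by
    intro t
    induction t with
    | zero => simp
    | succ t ih =>
      rw [Finset.sum_range_succ, Finset.sum_range_succ (n := t + 1)]
      have h1 : x (a + 2 * (t + 1)) ≤ x (a + 2 * (t + 1) - 1) := hx (by omega)
      have h2 : a + 2 * (t + 1 + 1) - 1 = a + 2 * (t + 1) + 1 := by omega
      rw [h2]
      linarith
  have hle : ∑ i ∈ Finset.range t, x (a + 2 * i + 1) ≤ ∑ i ∈ Finset.range t, x (a + 2 * i) :=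
    Finset.sum_le_sum fun i _ => hx (Nat.le_succ _)
  have hd : ∑ i ∈ Finset.range t, x (a + 2 * i) - ∑ i ∈ Finset.range t, x (a + 2 * i + 1)
      ≤ x a - x (a + 2 * t - 1) := by
    obtain ⟨t, rfl⟩ := Nat.exists_eq_succ_of_ne_zero ht.ne'
    exact hdiff t
  have hk := key t
  have hparts : ∀ t, ∀ j < 2, ∑ i ∈ Finset.Ico a (a + 2 * t) with (i - a) % 2 = j, x i
      = ∑ i ∈ Finset.range t, x (a + 2 * i + j) := by
    intro t j hj
    induction t with
    | zero => simp
    | succ t ih =>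
      rw [Finset.sum_filter] at ih ⊢
      rw [show a + 2 * (t + 1) = a + 2 * t + 1 + 1 by ring,
        Finset.sum_Ico_succ_top (by omega), Finset.sum_Ico_succ_top (by omega), ih,
        Finset.sum_range_succ, show a + 2 * t - a = 2 * t by omega,
        show a + 2 * t + 1 - a = 2 * t + 1 by omega]
      interval_cases j
      · simp
      · simp [Nat.add_mod]
  refine ⟨fun i => (i - a) % 2, fun i _ => Nat.mod_lt _ two_pos, fun j hj => ?_⟩
  rw [hparts t j hj]
  interval_cases j
  · simp only [add_zero]
    linarith
  · linarith

lemma mul_le_sum_Ico (hx : Antitone x) (a c : ℕ) :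
    (c : ℝ) * x (a + c - 1) ≤ ∑ i ∈ Finset.Ico a (a + c), x i := by
  have := Finset.card_nsmul_le_sum (Finset.Ico a (a + c)) x (x (a + c - 1)) fun i hi =>
    hx (by have := (Finset.mem_Ico.mp hi).2; omega)
  simpa using this

/-- In an antitone sequence, the last terms of a segment have at most the average weight. -/
lemma tail_mul_le (hx : Antitone x) (a b c : ℕ) :
    ((b : ℝ) + c) * ∑ i ∈ Finset.Ico (a + b) (a + b + c), x i
      ≤ c * ∑ i ∈ Finset.Ico a (a + b + c), x i := by
  rw [← Finset.sum_Ico_consecutive x (Nat.le_add_right a b) (Nat.le_add_right (a + b) c)]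
  have h1 : (b : ℝ) * x (a + b) ≤ ∑ i ∈ Finset.Ico a (a + b), x i := by
    have := Finset.card_nsmul_le_sum (Finset.Ico a (a + b)) x (x (a + b)) fun i hi =>
      hx (Finset.mem_Ico.mp hi).2.le
    simpa using this
  have h2 : ∑ i ∈ Finset.Ico (a + b) (a + b + c), x i ≤ (c : ℝ) * x (a + b) := by
    have := Finset.sum_le_card_nsmul (Finset.Ico (a + b) (a + b + c)) x (x (a + b)) fun i hi =>
      hx (Finset.mem_Ico.mp hi).1
    simpa using this
  have h3 := mul_le_mul_of_nonneg_left h1 (Nat.cast_nonneg (α := ℝ) c)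
  have h4 := mul_le_mul_of_nonneg_left h2 (Nat.cast_nonneg (α := ℝ) b)
  nlinarith

end Sequences

section Extremal

variable {x : ℕ → ℝ} {b : ℝ} {n k : ℕ}

lemma sum_Ico_one_le {c : ℝ} (hsum : ∀ r, ∑ i ∈ Finset.range r, x i ≤ x 0 + c) (r : ℕ) :
    ∑ i ∈ Finset.Ico 1 (r + 1), x i ≤ c := by
  have := hsum (r + 1)
  rw [Finset.range_eq_Ico, Finset.sum_eq_sum_Ico_succ_bot (Nat.succ_pos r)] at this
  simp only [zero_add] at this
  linarith

/-- Packing when bundles hold two objects. -/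
lemma packable_range_of_pair (hn : 2 ≤ n) (hx0 : ∀ i, 0 ≤ x i) (hx : Antitone x) (hb : 0 ≤ b)
    (h0 : x 0 ≤ 2 * b) (hsum : ∀ r, ∑ i ∈ Finset.range r, x i ≤ x 0 + n * b) (r : ℕ) :
    Packable x (2 * b) n (Finset.range (r + 1)) := by
  obtain ⟨p, rfl⟩ : ∃ p, n = 1 + p := ⟨n - 1, by omega⟩
  have h1 : Packable x (2 * b) 1 (Finset.Ico 0 1) := packable_one (by simpa using h0)
  have h2 : Packable x (2 * b) p (Finset.Ico 1 (r + 1)) := by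
    refine packable_two_mul hb hx0 (by omega) (fun i _ => (hx (Nat.zero_le i)).trans h0) ?_
    have := sum_Ico_one_le hsum r
    push_cast at this
    linarith
  have h3 := h1.union h2 (Finset.Ico_disjoint_Ico_consecutive _ _ _)
  rwa [Finset.Ico_union_Ico_eq_Ico (Nat.zero_le _) (by omega), ← Finset.range_eq_Ico] at h3

lemma packable_blocks_union {B : ℝ} {p q c l : ℕ} (hx : Antitone x)
    (h0 : (c : ℝ) * x 0 ≤ B) (hB : 0 ≤ B)
    (h : Packable x B q (Finset.Ico (p * c) (p * c + l))) :
    Packable x B (p + q) (Finset.range (p * c + l)) := by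
  have h1 := packable_blocks (fun i => hx (Nat.zero_le i)) h0 hB p
  rw [Finset.range_eq_Ico] at h1
  have h2 := h1.union h (Finset.Ico_disjoint_Ico_consecutive _ _ _)
  rwa [Finset.Ico_union_Ico_eq_Ico (Nat.zero_le _) (by omega), ← Finset.range_eq_Ico] at h2

lemma packable_range_add_one (hn : 2 ≤ n) (hk : 1 ≤ k) (hx : Antitone x)
    (hb : 0 ≤ b) (h0 : ((k : ℝ) + 1) * x 0 ≤ (k + 2) * b)
    (hsum : ∀ r, ∑ i ∈ Finset.range r, x i ≤ x 0 + (n * (k + 1)) * b) :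
    Packable x ((k + 2) * b) n (Finset.range (n * (k + 1) + 1)) := by
  obtain ⟨p, rfl⟩ : ∃ p, n = p + 1 := ⟨n - 1, by omega⟩
  obtain ⟨d, hd⟩ : ∃ d, p * (k + 1) = 1 + d := by
    have : 0 < p * (k + 1) := Nat.mul_pos (by omega) (by omega)
    exact ⟨p * (k + 1) - 1, by omega⟩
  rw [show (p + 1) * (k + 1) + 1 = p * (k + 1) + (k + 2) by ring]
  refine packable_blocks_union hx (by push_cast; exact h0) (by positivity) (packable_one ?_)
  have h1 := tail_mul_le hx 1 d (k + 2)
  have h2 := sum_Ico_one_le hsum (d + (k + 2))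
  rw [show d + (k + 2) + 1 = 1 + d + (k + 2) by ring] at h2
  rw [hd]
  have hd' : (p : ℝ) * (k + 1) = 1 + d := by exact_mod_cast hd
  have e : ((p + 1 : ℕ) : ℝ) * (k + 1) = d + (k + 2) := by
    push_cast
    linarith
  rw [e] at h2
  push_cast at h1
  have h3 := mul_le_mul_of_nonneg_left h2 (by positivity : (0 : ℝ) ≤ k + 2)
  refine le_of_mul_le_mul_left (a := (d : ℝ) + (k + 2)) ?_ (by positivity)
  linarith

lemma packable_range_add_two (hn : 2 ≤ n) (hk : 1 ≤ k) (hnk : ¬(n = 2 ∧ k = 1))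
    (hx : Antitone x) (hb : 0 ≤ b) (h0 : ((k : ℝ) + 1) * x 0 ≤ (k + 2) * b)
    (hsum : ∀ r, ∑ i ∈ Finset.range r, x i ≤ x 0 + (n * (k + 1)) * b)
    (hs : n * b < x 0 + (n - 1) * x (n * (k + 1) + 1)) :
    Packable x ((k + 2) * b) n (Finset.range (n * (k + 1) + 2)) := by
  obtain ⟨p, rfl⟩ : ∃ p, n = p + 2 := ⟨n - 2, by omega⟩
  rw [show (p + 2) * (k + 1) + 2 = p * (k + 1) + 2 * (k + 2) by ring]
  refine packable_blocks_union hx (by push_cast; exact h0) (by positivity)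
    (packable_alternating hx _ _ (by omega) ?_)
  rw [show p * (k + 1) + 2 * (k + 2) - 1 = (p + 2) * (k + 1) + 1 by
    rw [show p * (k + 1) + 2 * (k + 2) = (p + 2) * (k + 1) + 1 + 1 by ring]; rfl]
  set s := x ((p + 2) * (k + 1) + 1)
  push_cast at hs
  have hkr : (1 : ℝ) ≤ k := by exact_mod_cast hk
  rcases Nat.eq_zero_or_pos p with rfl | hp
  · have hk2 : (2 : ℝ) ≤ k := by exact_mod_cast (show 2 ≤ k by omega)
    have h1 := hsum (2 * (k + 2))
    rw [Finset.range_eq_Ico] at h1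
    simp only [zero_mul, zero_add] at *
    push_cast at *
    have h2 : 3 * x 0 ≤ 4 * b := by nlinarith
    linarith
  · obtain ⟨q, hq⟩ : ∃ q, p * (k + 1) = 1 + q := by
      have : 0 < p * (k + 1) := Nat.mul_pos (by omega) (by omega)
      exact ⟨p * (k + 1) - 1, by omega⟩
    have hq1 : 1 ≤ q := by nlinarith
    have hq1r : (1 : ℝ) ≤ q := by exact_mod_cast hq1
    have hq' : (p : ℝ) * (k + 1) = 1 + q := by exact_mod_cast hq
    have h1 := sum_Ico_one_le hsum (q + 2 * (k + 2))
    rw [show q + 2 * (k + 2) + 1 = 1 + q + 2 * (k + 2) by ring,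
      ← Finset.sum_Ico_consecutive x (Nat.le_add_right 1 q) (Nat.le_add_right (1 + q) _)] at h1
    have h2 : (q : ℝ) * x (1 + q) ≤ ∑ i ∈ Finset.Ico 1 (1 + q), x i :=
      le_trans (mul_le_mul_of_nonneg_left (hx (by omega)) (by positivity))
        (mul_le_sum_Ico hx 1 q)
    have h3 : s ≤ x (1 + q) := hx (by rw [← hq]; nlinarith)
    have e : ((p + 2 : ℕ) : ℝ) * (k + 1) = q + 2 * k + 3 := by
      push_cast
      linarith
    rw [e] at h1
    rw [hq]
    have h4 : ((q : ℝ) + k + 1) * b ≤ (q + k + 2) * s := by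
      have : ((k : ℝ) + 1) * ((p + 2) * b) ≤ (k + 1) * (x 0 + (p + 2 - 1) * s) :=
        mul_le_mul_of_nonneg_left hs.le (by positivity)
      have e1 : ((k : ℝ) + 1) * ((p + 2) * b) = (q + 2 * k + 3) * b := by
        linear_combination b * hq'
      have e2 : ((k : ℝ) + 1) * (x 0 + (p + 2 - 1) * s)
          = (k + 1) * x 0 + (q + k + 2) * s := by
        linear_combination s * hq'
      linarith
    have h5 : ((q : ℝ) - 1) * b ≤ q * s := by
      refine le_of_mul_le_mul_left (a := (q : ℝ) + k + 2) ?_ (by positivity)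
      have := mul_le_mul_of_nonneg_left h4 (Nat.cast_nonneg (α := ℝ) q)
      nlinarith
    have h6 : ((q : ℝ) - 1) * s ≤ (q - 1) * x (1 + q) :=
      mul_le_mul_of_nonneg_left h3 (by linarith)
    linarith

lemma packable_range_add_three (hk : 2 ≤ k) (hx : Antitone x) (hb : 0 ≤ b)
    (h0 : ((k : ℝ) + 1) * x 0 ≤ (k + 2) * b)
    (hsum : ∀ r, ∑ i ∈ Finset.range r, x i ≤ x 0 + (2 * (k + 1)) * b)
    (hs : 2 * b < x 0 + x (2 * (k + 1) + 2)) :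
    Packable x ((k + 2) * b) 2 (Finset.range (2 * (k + 1) + 3)) := by
  have hkr : (2 : ℝ) ≤ k := by exact_mod_cast hk
  have htot := hsum (k + 2 + (k + 3))
  rw [Finset.range_eq_Ico, ← Finset.sum_Ico_consecutive x (Nat.zero_le (k + 2))
    (Nat.le_add_right _ _)] at htot
  have h1 : Packable x ((k + 2) * b) 1 (Finset.Ico 0 (k + 2)) := by
    refine packable_one ?_
    have h2 := mul_le_sum_Ico hx (k + 2) (k + 3)
    rw [show k + 2 + (k + 3) - 1 = 2 * (k + 1) + 2 by omega] at h2
    push_cast at h2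
    have h3 : ((k : ℝ) + 4) * x 0 ≤ (k + 6) * b := by
      refine le_of_mul_le_mul_left (a := (k : ℝ) + 1) ?_ (by positivity)
      have h4 := mul_le_mul_of_nonneg_left h0 (by positivity : (0 : ℝ) ≤ k + 4)
      have h5 := mul_nonneg (by linarith : (0 : ℝ) ≤ k - 2) hb
      linarith
    have h4 := mul_le_mul_of_nonneg_left hs.le (by positivity : (0 : ℝ) ≤ k + 3)
    linarith
  have h2 : Packable x ((k + 2) * b) 1 (Finset.Ico (k + 2) (k + 2 + (k + 3))) := by
    refine packable_one ?_
    have h3 := tail_mul_le hx 1 (k + 1) (k + 3)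
    have h4 := sum_Ico_one_le hsum (k + 1 + (k + 3))
    rw [show 1 + (k + 1) = k + 2 by ring] at h3
    rw [show k + 1 + (k + 3) + 1 = k + 2 + (k + 3) by ring] at h4
    push_cast at h3
    have h5 := mul_le_mul_of_nonneg_left h4 (by positivity : (0 : ℝ) ≤ k + 3)
    refine le_of_mul_le_mul_left (a := (k : ℝ) + 1 + (k + 3)) ?_ (by positivity)
    nlinarith
  have h3 := h1.union h2 (Finset.Ico_disjoint_Ico_consecutive _ _ _)
  rwa [Finset.Ico_union_Ico_eq_Ico (Nat.zero_le _) (by omega), ← Finset.range_eq_Ico,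
    show k + 2 + (k + 3) = 2 * (k + 1) + 3 by ring] at h3

lemma mul_le_of_sum_le {c : ℝ} (hx0 : ∀ i, 0 ≤ x i) (hx : Antitone x)
    (hsum : ∀ r, ∑ i ∈ Finset.range r, x i ≤ x 0 + c) {l r : ℕ} (hlr : l ≤ r) :
    (l : ℝ) * x r ≤ c := by
  have h1 := sum_Ico_one_le hsum r
  have h2 := mul_le_sum_Ico hx 1 r
  rw [show 1 + r - 1 = r by omega, add_comm 1 r] at h2
  have h3 : (l : ℝ) ≤ r := by exact_mod_cast hlr
  linarith [mul_le_mul_of_nonneg_right h3 (hx0 r)]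

theorem packable_range (hn : 2 ≤ n) (hnk : ¬(n = 2 ∧ k = 1)) (hx0 : ∀ i, 0 ≤ x i)
    (hx : Antitone x) (hb : 0 ≤ b) (h0 : ((k : ℝ) + 1) * x 0 ≤ (k + 2) * b)
    (hsum : ∀ r, ∑ i ∈ Finset.range r, x i ≤ x 0 + (n * (k + 1)) * b) {r : ℕ}
    (hr : n * (k + 1) + 1 ≤ r) : Packable x ((k + 2) * b) n (Finset.range r) := by
  rcases Nat.eq_zero_or_pos k with rfl | hk
  · obtain ⟨r, rfl⟩ : ∃ t, r = t + 1 := ⟨r - 1, by omega⟩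
    simp only [CharP.cast_eq_zero, zero_add, mul_one, one_mul] at *
    exact packable_range_of_pair hn hx0 hx hb h0 hsum r
  induction r, hr using Nat.le_induction with
  | base => exact packable_range_add_one hn hk hx hb h0 hsum
  | succ r hr ih =>
    by_cases hgreedy : ∑ i ∈ Finset.range r, x i ≤ n * ((k + 2) * b - x r)
    · rw [Finset.range_add_one]
      exact ih.insert (by simp) (by omega) hgreedy
    have hs : n * b < x 0 + (n - 1) * x r := by
      have := hsum (r + 1)
      rw [Finset.sum_range_succ] at this
      push Not at hgreedy
      linarith
    have hkr : (1 : ℝ) ≤ k := by exact_mod_cast hk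
    rcases hr.eq_or_lt with rfl | hr
    · exact packable_range_add_two hn hk hnk hx hb h0 hsum hs
    rcases hn.eq_or_lt with rfl | hn
    · have hk2 : 2 ≤ k := by omega
      have hk2r : (2 : ℝ) ≤ k := by exact_mod_cast hk2
      push_cast at hsum hs
      have hs' : 2 * b < x 0 + x r := by linarith
      rcases (Nat.succ_le_of_lt hr).eq_or_lt with rfl | hr
      · exact packable_range_add_three hk2 hx hb h0 hsum hs'
      · have h1 := mul_le_of_sum_le hx0 hx hsum (show 2 * k + 5 ≤ r by omega)
        push_cast at h1
        have h2 : k * b < (k + 1) * x r := by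
          have h3 := mul_lt_mul_of_pos_left hs' (by positivity : (0 : ℝ) < k + 1)
          linarith
        have h3 := mul_le_mul_of_nonneg_left h1 (by positivity : (0 : ℝ) ≤ k + 1)
        have h4 := mul_lt_mul_of_pos_left h2 (by positivity : (0 : ℝ) < 2 * k + 5)
        have h5 := mul_nonneg (by linarith : (0 : ℝ) ≤ k - 2) hb
        linarith
    · have h1 := mul_le_of_sum_le hx0 hx hsum (show n * (k + 1) + 2 ≤ r by omega)
      push_cast at h1
      have hn3 : (3 : ℝ) ≤ n := by exact_mod_cast hn
      obtain ⟨w, hw⟩ : ∃ w : ℝ, ((n : ℝ) - 1) * (k + 1) = w := ⟨_, rfl⟩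
      have hwk : (k : ℝ) + 3 ≤ w := by nlinarith
      have e : (n : ℝ) * (k + 1) = w + k + 1 := by linarith
      rw [e] at h1
      have h2 : (w - 1) * b < w * x r := by
        have h3 := mul_lt_mul_of_pos_left hs (by positivity : (0 : ℝ) < k + 1)
        have e1 : ((k : ℝ) + 1) * (n * b) = (w + k + 1) * b := by linear_combination b * e
        have e2 : ((k : ℝ) + 1) * (x 0 + (n - 1) * x r) = (k + 1) * x 0 + w * x r := by
          linear_combination x r * hw
        linarith
      have h3 := mul_le_mul_of_nonneg_left h1 (by linarith : 0 ≤ w)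
      have h4 := mul_lt_mul_of_pos_left h2 (by linarith : 0 < w + k + 1 + 2)
      nlinarith [mul_nonneg (by linarith : 0 ≤ w - k - 3) hb]

end Extremal

section MMS

variable {n m : ℕ} {v : Fin m → ℝ} {B : ℝ}

lemma MMS_le_of_allocation [NeZero n] (A : Fin m → Fin n)
    (h : ∀ j, ∑ e ∈ Finset.univ.filter (fun e => A e = j), v e ≤ B) : MMS n m v ≤ B :=
  (ciInf_le (Set.finite_range _).bddBelow A).trans (ciSup_le h)

/-- The weights of `v` listed by position along `σ`, continued by zeros. -/
noncomputable def weightSeq (v : Fin m → ℝ) (σ : Equiv.Perm (Fin m)) (i : ℕ) : ℝ :=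
  if h : i < m then v (σ ⟨i, h⟩) else 0

lemma weightSeq_fin (σ : Equiv.Perm (Fin m)) (i : Fin m) : weightSeq v σ i = v (σ i) := by
  simp [weightSeq]

lemma weightSeq_nonneg (hv : ∀ e, 0 ≤ v e) (σ : Equiv.Perm (Fin m)) (i : ℕ) :
    0 ≤ weightSeq v σ i := by
  unfold weightSeq
  split_ifs
  · exact hv _
  · exact le_rfl

lemma weightSeq_antitone (hv : ∀ e, 0 ≤ v e) {σ : Equiv.Perm (Fin m)}
    (hσ : Antitone (v ∘ σ)) : Antitone (weightSeq v σ) := by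
  intro i j hij
  by_cases hj : j < m
  · have hi : i < m := hij.trans_lt hj
    simp only [weightSeq, hi, hj, dif_pos]
    exact hσ (show (⟨i, hi⟩ : Fin m) ≤ ⟨j, hj⟩ from hij)
  · rw [show weightSeq v σ j = 0 by simp [weightSeq, hj]]
    exact weightSeq_nonneg hv σ i

lemma sum_range_weightSeq (σ : Equiv.Perm (Fin m)) :
    ∑ i ∈ Finset.range m, weightSeq v σ i = ∑ e, v e := by
  rw [← Fin.sum_univ_eq_sum_range, ← Equiv.sum_comp σ v]
  exact Finset.sum_congr rfl fun i _ => weightSeq_fin σ i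

lemma sum_range_weightSeq_le (hv : ∀ e, 0 ≤ v e) (σ : Equiv.Perm (Fin m)) (r : ℕ) :
    ∑ i ∈ Finset.range r, weightSeq v σ i ≤ ∑ e, v e := by
  rw [← sum_range_weightSeq σ]
  rcases le_total r m with h | h
  · exact Finset.sum_le_sum_of_subset_of_nonneg (Finset.range_mono h)
      fun i _ _ => weightSeq_nonneg hv σ i
  · refine (Finset.sum_subset (Finset.range_mono h) fun i _ hi => ?_).ge
    simp only [Finset.mem_range] at hi
    simp [weightSeq, hi]

lemma MMS_le_of_packable (hn : 0 < n) (σ : Equiv.Perm (Fin m))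
    (h : Packable (weightSeq v σ) B n (Finset.range m)) : MMS n m v ≤ B := by
  have : NeZero n := ⟨hn.ne'⟩
  obtain ⟨A, hA, hAB⟩ := h
  refine MMS_le_of_allocation
    (fun e => ⟨A (σ.symm e), hA _ (Finset.mem_range.mpr (σ.symm e).2)⟩) fun j => ?_
  refine le_of_eq_of_le ?_ (hAB j j.2)
  rw [Finset.sum_filter, Finset.sum_filter, ← Equiv.sum_comp σ,
    ← Fin.sum_univ_eq_sum_range (fun i => if A i = j then weightSeq v σ i else 0)]
  exact Finset.sum_congr rfl fun i _ => by simp [weightSeq_fin, Fin.ext_iff]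

lemma exists_antitone_comp_perm (v : Fin m → ℝ) :
    ∃ σ : Equiv.Perm (Fin m), Antitone (v ∘ σ) :=
  ⟨Tuple.sort (-v), fun i j hij => by
    have := Tuple.monotone_sort (-v) hij
    simpa using this⟩

lemma weightSeq_zero (hm : 0 < m) {σ : Equiv.Perm (Fin m)} (hσ : Antitone (v ∘ σ)) :
    weightSeq v σ 0 = ⨆ e, v e := by
  have : Nonempty (Fin m) := ⟨⟨0, hm⟩⟩
  rw [show weightSeq v σ 0 = v (σ ⟨0, hm⟩) by simp [weightSeq, hm]]
  refine le_antisymm (le_ciSup (Set.finite_range v).bddAbove _) (ciSup_le fun e => ?_)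
  have := hσ (show (⟨0, hm⟩ : Fin m) ≤ σ.symm e from Nat.zero_le _)
  simpa using this

end MMS

theorem stmt4 (n k : ℕ) (hn : 2 ≤ n) (hnk : ¬(n = 2 ∧ k = 1)) (α : ℝ)
    (hD1 : 1/((k:ℝ)*(n:ℝ)+(n:ℝ)+1) < α)
    (hD2 : α ≤ ((k:ℝ)+2)/((n:ℝ)*((k:ℝ)+1)^2 + (k:ℝ) + 2))
    (m : ℕ) (hm : k*n + n + 1 ≤ m) (v : Fin m → ℝ) (hv : Vmem α m v) :
    MMS n m v ≤ (((k:ℝ)+2)/((k:ℝ)+1)) * (1-α)/(n:ℝ) := by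
  obtain ⟨⟨hv0, hv1⟩, hα⟩ := hv
  obtain ⟨σ, hσ⟩ := exists_antitone_comp_perm v
  have hx0 := weightSeq_zero (by omega) hσ
  rw [hα] at hx0
  have hn0 : (0 : ℝ) < n := by exact_mod_cast (by omega : 0 < n)
  obtain ⟨b, hb⟩ : ∃ b : ℝ, b = (1 - α) / (n * (k + 1)) := ⟨_, rfl⟩
  have hb' : (n * (k + 1)) * b = 1 - α := by
    rw [hb]
    field_simp
  have hB : (((k:ℝ)+2)/((k:ℝ)+1)) * (1-α)/(n:ℝ) = (k + 2) * b := by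
    rw [hb]
    field_simp
  rw [le_div_iff₀ (by positivity)] at hD2
  have hα1 : α ≤ 1 := by
    by_contra! h
    nlinarith [(by positivity : 0 < (n:ℝ) * ((k:ℝ)+1)^2)]
  have hb0 : 0 ≤ b := by
    rw [hb]
    exact div_nonneg (by linarith) (by positivity)
  rw [hB]
  refine MMS_le_of_packable (by omega) σ (packable_range hn hnk (weightSeq_nonneg hv0 σ)
    (weightSeq_antitone hv0 hσ) hb0 ?_ (fun r => ?_) (by linarith))
  · rw [hx0]
    refine le_of_mul_le_mul_left (a := (n : ℝ) * (k + 1)) ?_ (by positivity)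
    have : (n : ℝ) * (k + 1) * ((k + 2) * b) = (k + 2) * (1 - α) := by
      rw [← hb']
      ring
    rw [this]
    linarith
  · rw [hx0, hb']
    have := sum_range_weightSeq_le hv0 σ r
    linarith
end

section
/- Let n ≥ 2 and k ≥ 0 be integers, not simultaneously n = 2 and k = 1, let α ∈ D(n,k), and let m ≥ kn + n + 1. The disutility function v on m objects that assigns value α to one object, value (1−α)/(n(k+1)) to n(k+1) objects, and value 0 to the remaining m − n(k+1) − 1 objects belongs to V(α;m) and satisfies MMS_n(v) = ((k+2)/(k+1))·(1−α)/n. -/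
open Finset

/-- The disutility function with value `a` at object `0`, value `b` at objects `1, …, N`, and
value `0` at all further objects. -/
noncomputable def twoValued (a b : ℝ) (N e : ℕ) : ℝ :=
  if e = 0 then a else if e ≤ N then b else 0

lemma twoValued_nonneg {a b : ℝ} (ha : 0 ≤ a) (hb : 0 ≤ b) (N e : ℕ) :
    0 ≤ twoValued a b N e := by
  unfold twoValued
  split_ifs <;> first | assumption | exact le_rfl

lemma twoValued_le {a b : ℝ} (hb : 0 ≤ b) (hab : b ≤ a) (N e : ℕ) :
    twoValued a b N e ≤ a := by
  unfold twoValued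
  split_ifs <;> linarith

lemma le_twoValued {a b : ℝ} (hab : b ≤ a) {N e : ℕ} (he : e ≤ N) :
    b ≤ twoValued a b N e := by
  unfold twoValued
  split_ifs
  exacts [hab, le_rfl]

lemma sum_twoValued (a b : ℝ) {N m : ℕ} (hm : N + 1 ≤ m) :
    ∑ e : Fin m, twoValued a b N e = a + N * b := by
  rw [Fin.sum_univ_eq_sum_range (twoValued a b N) m,
    ← Finset.sum_subset (Finset.range_mono hm), Finset.sum_range_succ',
    Finset.sum_congr rfl (g := fun _ => b)]
  · simp [twoValued, add_comm]
  · intro e he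
    simp only [Finset.mem_range] at he
    simp [twoValued, Nat.succ_le_of_lt he]
  · intro e _ he
    simp only [Finset.mem_range] at he
    unfold twoValued
    rw [if_neg (by omega), if_neg (by omega)]

lemma sum_twoValued_le_card {a b : ℝ} (hb : 0 ≤ b) {N m : ℕ} (T : Finset (Fin m))
    (s : Finset ℕ) (h0 : ∀ e ∈ T, (e : ℕ) ≠ 0) (hs : ∀ e ∈ T, (e : ℕ) ≤ N → (e : ℕ) ∈ s) :
    ∑ e ∈ T, twoValued a b N e ≤ #s * b := by
  calc ∑ e ∈ T, twoValued a b N e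
      ≤ ∑ e ∈ T, if (e : ℕ) ∈ s then b else 0 := by
        refine Finset.sum_le_sum fun e he => ?_
        have := h0 e he
        have := hs e he
        unfold twoValued
        split_ifs <;> first | exact le_rfl | exact hb | tauto
    _ = #(T.filter (fun e : Fin m => (e : ℕ) ∈ s)) * b := by
        rw [← Finset.sum_filter, Finset.sum_const, nsmul_eq_mul]
    _ ≤ #s * b := by
        gcongr
        refine Finset.card_le_card_of_injOn (fun e : Fin m => (e : ℕ)) ?_
          Fin.val_injective.injOn
        intro e he
        exact (Finset.mem_filter.mp he).2

/-- Among `n` agents and `n * c + 1` objects of value at least `b`, some agent receives at least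
`c + 1` of them. -/
lemma exists_le_sum_of_le {n m c : ℕ} {b : ℝ} {v : Fin m → ℝ} (hb : 0 ≤ b) (hv : ∀ e, 0 ≤ v e)
    (hm : n * c + 1 ≤ m) (hvb : ∀ e : Fin m, (e : ℕ) ≤ n * c → b ≤ v e) (A : Fin m → Fin n) :
    ∃ j, ((c : ℝ) + 1) * b ≤ ∑ e ∈ univ.filter (fun e => A e = j), v e := by
  let last : Fin m := ⟨n * c, hm⟩
  obtain ⟨j, -, hj⟩ := Finset.exists_lt_card_fiber_of_mul_lt_card_of_maps_to
    (s := Finset.Iic last) (t := Finset.univ) (f := A) (n := c) (fun _ _ => Finset.mem_univ _)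
    (by simp [last])
  refine ⟨j, ?_⟩
  calc ((c : ℝ) + 1) * b ≤ #{e ∈ Finset.Iic last | A e = j} * b := by
        gcongr
        exact_mod_cast hj
    _ ≤ ∑ e ∈ Finset.Iic last with A e = j, v e := by
        rw [← nsmul_eq_mul]
        refine Finset.card_nsmul_le_sum _ _ _ fun e he => hvb e ?_
        exact Fin.le_def.mp (Finset.mem_Iic.mp (Finset.mem_filter.mp he).1)
    _ ≤ _ := Finset.sum_le_sum_of_subset_of_nonneg
        (Finset.filter_subset_filter _ (Finset.subset_univ _)) fun e _ _ => hv e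

/-- Giving the large object and `k + 2 - n` small objects to one agent, and at most `k + 2` small
objects to every other agent, keeps each bundle below `(k + 2) * b`. -/
lemma exists_allocation_sum_twoValued_le {n k m : ℕ} (hn : 2 ≤ n) {a b : ℝ} (hb : 0 ≤ b)
    (ha : 0 ≤ a) (hab : a * (k + 1) ≤ (k + 2) * b) :
    ∃ A : Fin m → Fin n, ∀ j, ∑ e ∈ univ.filter (fun e => A e = j),
      twoValued a b (n * (k + 1)) e ≤ ((k : ℝ) + 2) * b := by
  obtain ⟨p, rfl⟩ : ∃ p, n = p + 1 := ⟨n - 1, by omega⟩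
  set N := (p + 1) * (k + 1) with hN
  refine ⟨fun e => if (e : ℕ) = 0 then Fin.last p else
    ⟨min p ((N - e) / (k + 2)), by omega⟩, fun j => ?_⟩
  set T := univ.filter (fun e : Fin m => (if (e : ℕ) = 0 then Fin.last p else
    (⟨min p ((N - e) / (k + 2)), by omega⟩ : Fin (p + 1))) = j) with hT
  have hmem : ∀ e ∈ T, (e : ℕ) ≠ 0 → min p ((N - e) / (k + 2)) = (j : ℕ) := by
    intro e he h0
    rw [hT, Finset.mem_filter, if_neg h0] at he
    exact congrArg Fin.val he.2
  by_cases hj : (j : ℕ) = p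
  · have hsmall : ∑ e ∈ T.filter (fun e : Fin m => (e : ℕ) ≠ 0), twoValued a b N e
        ≤ #(Finset.Icc 1 (k + 1 - p)) * b := by
      refine sum_twoValued_le_card hb _ _ (fun e he => (Finset.mem_filter.mp he).2) ?_
      intro e he heN
      obtain ⟨heT, h0⟩ := Finset.mem_filter.mp he
      have h1 := hmem e heT h0
      have h2 : p * (k + 2) ≤ N - e :=
        (Nat.le_div_iff_mul_le (by omega)).mp (by omega)
      have h3 : N = p * (k + 2) + k + 1 - p := by
        rw [hN, eq_comm]
        apply Nat.sub_eq_of_eq_add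
        ring
      rw [Finset.mem_Icc]
      omega
    have hlarge : ∑ e ∈ T.filter (fun e : Fin m => ¬ (e : ℕ) ≠ 0), twoValued a b N e ≤ a := by
      have hcard : #(T.filter (fun e : Fin m => ¬ (e : ℕ) ≠ 0)) ≤ 1 := by
        refine Finset.card_le_one.mpr fun x hx y hy => Fin.ext ?_
        have := (Finset.mem_filter.mp hx).2
        have := (Finset.mem_filter.mp hy).2
        omega
      calc _ ≤ #(T.filter (fun e : Fin m => ¬ (e : ℕ) ≠ 0)) • a := by
            refine Finset.sum_le_card_nsmul _ _ _ fun e he => ?_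
            rw [twoValued, if_pos (not_not.mp (Finset.mem_filter.mp he).2)]
        _ ≤ 1 • a := by gcongr
        _ = a := one_nsmul a
    rw [← Finset.sum_filter_add_sum_filter_not T (fun e : Fin m => (e : ℕ) ≠ 0)]
    rw [Nat.card_Icc] at hsmall
    have hk : (0 : ℝ) ≤ k := Nat.cast_nonneg k
    rcases le_or_gt (k + 1) p with hp | hp
    · rw [Nat.sub_eq_zero_of_le hp] at hsmall
      simp only [zero_add, tsub_self, Nat.cast_zero, zero_mul] at hsmall
      nlinarith [mul_nonneg ha hk]
    · have ha2 : a ≤ 2 * b := by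
        by_contra! h
        nlinarith [mul_nonneg hk hb]
      have hc : ((k + 1 - p + 1 - 1 : ℕ) : ℝ) ≤ k := by
        exact_mod_cast (by omega : k + 1 - p + 1 - 1 ≤ k)
      nlinarith [mul_le_mul_of_nonneg_right hc hb]
  · refine (sum_twoValued_le_card hb T
      (Finset.Icc (N - j * (k + 2) - (k + 1)) (N - j * (k + 2))) ?_ ?_).trans ?_
    · intro e he h0
      rw [hT, Finset.mem_filter, if_pos h0] at he
      exact hj (by rw [← he.2, Fin.val_last])
    · intro e he heN
      by_cases h0 : (e : ℕ) = 0
      · rw [hT, Finset.mem_filter, if_pos h0] at he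
        exact absurd (by rw [← he.2, Fin.val_last]) hj
      have h1 := hmem e he h0
      have h2 : (N - e) / (k + 2) = (j : ℕ) := by omega
      have h3 := Nat.div_add_mod (N - e) (k + 2)
      have h4 := Nat.mod_lt (N - e) (show k + 2 > 0 by omega)
      rw [h2, mul_comm] at h3
      rw [Finset.mem_Icc]
      omega
    · gcongr
      rw [Nat.card_Icc]
      exact_mod_cast (by omega :
        N - j * (k + 2) + 1 - (N - j * (k + 2) - (k + 1)) ≤ k + 2)

theorem stmt5 (n k : ℕ) (hn : 2 ≤ n) (hnk : ¬(n = 2 ∧ k = 1)) (α : ℝ)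
    (hD1 : 1/((k:ℝ)*(n:ℝ)+(n:ℝ)+1) < α)
    (hD2 : α ≤ ((k:ℝ)+2)/((n:ℝ)*((k:ℝ)+1)^2 + (k:ℝ) + 2))
    (m : ℕ) (hm : k*n + n + 1 ≤ m) (v : Fin m → ℝ)
    (hvdef : ∀ e : Fin m, v e =
      if (e:ℕ) = 0 then α
      else if (e:ℕ) ≤ n*(k+1) then (1-α)/((n:ℝ)*((k:ℝ)+1))
      else 0) :
    Vmem α m v ∧ MMS n m v = (((k:ℝ)+2)/((k:ℝ)+1)) * (1-α)/(n:ℝ) := by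
  have hn0 : (0 : ℝ) < n := by positivity
  have hk : (0 : ℝ) ≤ k := Nat.cast_nonneg k
  have hN0 : (0 : ℝ) < n * (k + 1) := by positivity
  have hα0 : 0 < α := lt_trans (by positivity) hD1
  have hmN : n * (k + 1) + 1 ≤ m := by linarith
  rw [div_lt_iff₀ (by positivity)] at hD1
  rw [le_div_iff₀ (by positivity)] at hD2
  set β : ℝ := (1 - α) / (n * (k + 1)) with hβ
  have hβN : n * (k + 1) * β = 1 - α := mul_div_cancel₀ _ hN0.ne'
  have hα1 : α ≤ 1 := by
    by_contra! h
    nlinarith [mul_pos hn0 (by positivity : (0 : ℝ) < (k + 1) ^ 2)]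
  have hβ0 : 0 ≤ β := div_nonneg (by linarith) hN0.le
  have hβα : β ≤ α := by
    rw [hβ, div_le_iff₀ hN0]
    linarith
  have hαβ : α * (k + 1) ≤ (k + 2) * β := by
    rw [hβ, mul_div_assoc', le_div_iff₀ hN0]
    linarith
  have hv : v = fun e : Fin m => twoValued α β (n * (k + 1)) e := funext hvdef
  have hv0 : ∀ e, 0 ≤ v e := fun e => by
    rw [hv]
    exact twoValued_nonneg hα0.le hβ0 _ _
  have hm0 : 0 < m := by omega
  have : Nonempty (Fin m) := ⟨⟨0, hm0⟩⟩
  have : Nonempty (Fin n) := ⟨⟨0, by omega⟩⟩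
  refine ⟨⟨⟨hv0, ?_⟩, le_antisymm (ciSup_le fun e => ?_) ?_⟩, ?_⟩
  · rw [hv, sum_twoValued α β hmN]
    push_cast
    linarith
  · rw [hv]
    exact twoValued_le hβ0 hβα _ _
  · refine le_ciSup_of_le (Set.finite_range v).bddAbove ⟨0, hm0⟩ ?_
    simp [hv, twoValued]
  · have hval : ((k : ℝ) + 2) / (k + 1) * (1 - α) / n = (k + 2) * β := by
      rw [hβ]
      field_simp
    rw [hval]
    refine le_antisymm ?_ (le_ciInf fun A => ?_)
    · obtain ⟨A, hA⟩ := exists_allocation_sum_twoValued_le (m := m) hn hβ0 hα0.le hαβ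
      rw [hv]
      exact ciInf_le_of_le (Set.finite_range _).bddBelow A (ciSup_le hA)
    · obtain ⟨j, hj⟩ := exists_le_sum_of_le hβ0 hv0 hmN
        (fun e he => by rw [hv]; exact le_twoValued hβα he) A
      refine le_ciSup_of_le (Set.finite_range _).bddAbove j (le_trans (le_of_eq ?_) hj)
      push_cast
      ring
end

section
/- Let n ≥ 2 and k ≥ 0 be integers, not simultaneously n = 2 and k = 1, let α ∈ I(n,k), and let m ≥ ⌈1/α⌉. Then for every v ∈ V(α;m), MMS_n(v) ≤ (k+1)α. -/
open Finset

theorem load_insert_update {ι κ : Type*} [DecidableEq ι] [DecidableEq κ] (w : ι → ℝ)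
    (S : Finset ι) (x : ι) (hx : x ∉ S) (A : ι → κ) (i j : κ) :
    ∑ e ∈ insert x S with Function.update A x i e = j, w e =
      (∑ e ∈ S with A e = j, w e) + if i = j then w x else 0 := by
  have h : S.filter (fun e => Function.update A x i e = j) = S.filter (fun e => A e = j) := by
    refine Finset.filter_congr fun e he => ?_
    rw [Function.update_of_ne (by rintro rfl; exact hx he)]
  rw [Finset.filter_insert, Function.update_self, h]
  split_ifs with hij
  · rw [Finset.sum_insert (by simp [hx]), add_comm]
  · simp

theorem exists_map_card_fiber_le {ι κ : Type*} [DecidableEq ι] [DecidableEq κ]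
    (J : Finset κ) (hJ : J.Nonempty) (c : ℕ) (S : Finset ι) (hS : #S ≤ #J * c) :
    ∃ A : ι → κ, (∀ e, A e ∈ J) ∧ ∀ j, #{e ∈ S | A e = j} ≤ c := by
  induction S using Finset.induction_on with
  | empty =>
    obtain ⟨j, hj⟩ := hJ
    exact ⟨fun _ => j, fun _ => hj, by simp⟩
  | insert x S hx ih =>
    rw [Finset.card_insert_of_notMem hx] at hS
    obtain ⟨A, hAJ, hA⟩ := ih (by omega)
    obtain ⟨i, hi, hic⟩ : ∃ i ∈ J, #{e ∈ S | A e = i} < c := by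
      by_contra! h
      have h1 := Finset.card_eq_sum_card_fiberwise (f := A) (s := S) (t := J) (fun e _ => hAJ e)
      have h2 := Finset.card_nsmul_le_sum J (fun i => #{e ∈ S | A e = i}) c h
      rw [smul_eq_mul] at h2
      omega
    refine ⟨Function.update A x i, fun e => ?_, fun j => ?_⟩
    · by_cases he : e = x
      · subst he; simpa using hi
      · rw [Function.update_of_ne he]; exact hAJ e
    · have h := load_insert_update (fun _ => (1 : ℝ)) S x hx A i j
      simp only [Finset.sum_const, nsmul_eq_mul, mul_one] at h
      have hj := hA j
      split_ifs at h with hij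
      · subst hij
        have : #{e ∈ insert x S | Function.update A x i e = i} = #{e ∈ S | A e = i} + 1 := by
          exact_mod_cast h
        omega
      · rw [add_zero] at h
        have : #{e ∈ insert x S | Function.update A x i e = j} = #{e ∈ S | A e = j} := by
          exact_mod_cast h
        omega

theorem exists_subset_card_eq_sum_le {ι : Type*} [DecidableEq ι] (w : ι → ℝ) (a : ℝ) (c : ℕ)
    (U : Finset ι) (hc : c ≤ #U) (hU : ∑ e ∈ U, w e ≤ #U * a) :
    ∃ Q ⊆ U, #Q = c ∧ ∑ e ∈ Q, w e ≤ c * a := by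
  induction U using Finset.strongInduction with
  | H U ih =>
    rcases hc.eq_or_lt with h | h
    · exact ⟨U, subset_rfl, h.symm, by rwa [h]⟩
    by_cases hx : ∃ x ∈ U, a ≤ w x
    · obtain ⟨x, hx, hax⟩ := hx
      have hcard := Finset.card_erase_add_one hx
      have hsum := Finset.add_sum_erase U w hx
      obtain ⟨Q, hQ, hQc⟩ := ih (U.erase x) (Finset.erase_ssubset hx) (by omega) (by
        rw [← hcard] at hU
        push_cast at hU
        linarith)
      exact ⟨Q, hQ.trans (Finset.erase_subset _ _), hQc⟩
    · push Not at hx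
      obtain ⟨Q, hQ, hQc⟩ := Finset.exists_subset_card_eq hc
      refine ⟨Q, hQ, hQc, ?_⟩
      have := Finset.sum_le_card_nsmul Q w a fun e he => (hx e (hQ he)).le
      rwa [hQc, nsmul_eq_mul] at this

theorem exists_balanced_split {ι : Type*} [DecidableEq ι] (w : ι → ℝ) (δ : ℝ) (hδ : 0 ≤ δ)
    (c : ℕ) (S : Finset ι) (hc : #S = 2 * c) (hS : ∀ x ∈ S, ∀ y ∈ S, w x - w y ≤ δ) :
    ∃ X ⊆ S, |∑ e ∈ X, w e - ∑ e ∈ S \ X, w e| ≤ δ := by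
  induction c generalizing S with
  | zero =>
    obtain rfl : S = ∅ := Finset.card_eq_zero.mp (by omega)
    exact ⟨∅, subset_rfl, by simpa using hδ⟩
  | succ c ih =>
    obtain ⟨x, hx⟩ : S.Nonempty := Finset.card_pos.mp (by omega)
    have hcx := Finset.card_erase_add_one hx
    obtain ⟨y, hy⟩ : (S.erase x).Nonempty := Finset.card_pos.mp (by omega)
    have hcy := Finset.card_erase_add_one hy
    have hyS := Finset.mem_of_mem_erase hy
    have hsub : (S.erase x).erase y ⊆ S :=
      (Finset.erase_subset _ _).trans (Finset.erase_subset _ _)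
    obtain ⟨X, hX, hD⟩ := ih ((S.erase x).erase y) (by omega)
      fun a ha b hb => hS a (hsub ha) b (hsub hb)
    have hxX : x ∉ X := fun h => by simpa using hX h
    have hyX : y ∉ X := fun h => by simpa using hX h
    have h1 := Finset.sum_sdiff (f := w) hX
    have h2 := Finset.add_sum_erase S w hx
    have h3 := Finset.add_sum_erase (S.erase x) w hy
    have hxs : insert x X ⊆ S := Finset.insert_subset hx (hX.trans hsub)
    have hys : insert y X ⊆ S := Finset.insert_subset hyS (hX.trans hsub)
    have h4 := Finset.sum_sdiff (f := w) hxs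
    have h5 := Finset.sum_sdiff (f := w) hys
    rw [Finset.sum_insert hxX] at h4
    rw [Finset.sum_insert hyX] at h5
    have hxy := hS x hx y hyS
    have hyx := hS y hyS x hx
    rw [abs_le] at hD
    by_cases hcase : (∑ e ∈ X, w e - ∑ e ∈ (S.erase x).erase y \ X, w e) * (w x - w y) ≤ 0
    · refine ⟨insert x X, hxs, ?_⟩
      rw [Finset.sum_insert hxX, abs_le]
      rcases mul_nonpos_iff.mp hcase with h | h <;> constructor <;> linarith
    · refine ⟨insert y X, hys, ?_⟩
      rw [Finset.sum_insert hyX, abs_le]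
      rcases mul_pos_iff.mp (not_le.mp hcase) with h | h <;> constructor <;> linarith

theorem add_card_sub_one_mul_le_sum {κ : Type*} [Fintype κ] [DecidableEq κ] (L : κ → ℝ) (b : ℝ)
    (hL : ∀ j, b ≤ L j) (i : κ) : L i + ((Fintype.card κ : ℝ) - 1) * b ≤ ∑ j, L j := by
  rw [← Finset.add_sum_erase _ L (Finset.mem_univ i)]
  have h := Finset.card_nsmul_le_sum (Finset.univ.erase i) L b fun j _ => hL j
  have hc := Finset.card_erase_add_one (Finset.mem_univ i)
  have hc' : ((#(Finset.univ.erase i) : ℕ) : ℝ) + 1 = (Fintype.card κ : ℝ) := by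
    exact_mod_cast hc
  rw [nsmul_eq_mul] at h
  rw [← hc']
  linarith

/-- `n` bins of capacity `k + 1` can hold `n * (k + 1) + 1` items of size at most one whose
total size is below the threshold. -/
theorem exists_packing_of_card_eq {ι : Type*} [DecidableEq ι] (w : ι → ℝ)
    (hw1 : ∀ e, w e ≤ 1) (n k : ℕ) (hn : 2 ≤ n) (S : Finset ι) (e₁ : ι) (he₁ : e₁ ∈ S)
    (hwe₁ : w e₁ = 1) (hcard : #S = n * (k + 1) + 1)
    (hT : (∑ e ∈ S, w e) * (k + 2) ≤ n * (k + 1) ^ 2 + k + 2) :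
    ∃ A : ι → Fin n, ∀ j, ∑ e ∈ S with A e = j, w e ≤ k + 1 := by
  have hk2 : (0 : ℝ) < k + 2 := by positivity
  have hce := Finset.card_erase_add_one he₁
  have hcU : #(S.erase e₁) = n * (k + 1) := by omega
  have hnk : 2 * (k + 1) ≤ n * (k + 1) := Nat.mul_le_mul_right _ hn
  obtain ⟨Q, hQ, hQc, hQs⟩ := exists_subset_card_eq_sum_le w (((k : ℝ) + 1) / (k + 2)) (k + 2)
    (S.erase e₁) (by omega) (by
      have := Finset.add_sum_erase S w he₁
      rw [hcU, ← mul_div_assoc, le_div_iff₀ hk2]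
      push_cast
      nlinarith)
  have hQS : Q ⊆ S := hQ.trans (Finset.erase_subset _ _)
  have hQs' : ∑ e ∈ Q, w e ≤ k + 1 := by
    refine hQs.trans (le_of_eq ?_)
    push_cast
    field_simp
  let z : Fin n := ⟨0, by omega⟩
  have hJc : #(Finset.univ.erase z) = n - 1 := by simp
  obtain ⟨A, hAz, hA⟩ := exists_map_card_fiber_le (Finset.univ.erase z)
    (Finset.card_pos.mp (by omega)) (k + 1) (S \ Q) (by
      rw [Finset.card_sdiff_of_subset hQS, hJc, Nat.sub_mul]
      omega)
  refine ⟨fun e => if e ∈ Q then z else A e, fun j => ?_⟩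
  by_cases hj : j = z
  · subst hj
    have : S.filter (fun e => (if e ∈ Q then z else A e) = z) = Q := by
      ext e
      have := hAz e
      simp only [Finset.mem_erase] at this
      simp only [Finset.mem_filter]
      by_cases he : e ∈ Q
      · simp [he, hQS he]
      · simp [he, this.1]
    rw [this]
    exact hQs'
  · have : S.filter (fun e => (if e ∈ Q then z else A e) = j) =
        (S \ Q).filter (fun e => A e = j) := by
      ext e
      simp only [Finset.mem_filter, Finset.mem_sdiff]
      by_cases he : e ∈ Q
      · simp [he, Ne.symm hj]
      · simp [he]
    rw [this]
    have h := Finset.sum_le_card_nsmul ((S \ Q).filter (fun e => A e = j)) w 1 fun e _ => hw1 e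
    have h2 : ((#((S \ Q).filter (fun e => A e = j)) : ℕ) : ℝ) ≤ k + 1 := by
      exact_mod_cast hA j
    rw [nsmul_eq_mul, mul_one] at h
    exact h.trans h2

theorem exists_packing {ι : Type*} [DecidableEq ι] (w : ι → ℝ)
    (hw1 : ∀ e, w e ≤ 1) (n k : ℕ) (hn : 2 ≤ n) (hnk : ¬(n = 2 ∧ k = 1)) (e₁ : ι)
    (hwe₁ : w e₁ = 1) (N : ℕ) (S : Finset ι) (hw0 : ∀ e ∈ S, 0 ≤ w e) (he₁ : e₁ ∈ S)
    (hN : #S = N) (hT : (∑ e ∈ S, w e) * (k + 2) < n * (k + 1) ^ 2 + k + 2) :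
    ∃ A : ι → Fin n, ∀ j, ∑ e ∈ S with A e = j, w e ≤ k + 1 := by
  induction N generalizing S with
  | zero => simp_all
  | succ N ih =>
  have : NeZero n := ⟨by omega⟩
  rcases lt_trichotomy (#S) (n * (k + 1) + 1) with hc | hc | hc
  · obtain ⟨A, -, hA⟩ := exists_map_card_fiber_le (Finset.univ : Finset (Fin n))
      ⟨0, Finset.mem_univ _⟩ (k + 1) S (by rw [Finset.card_fin]; omega)
    refine ⟨A, fun j => ?_⟩
    have h := Finset.sum_le_card_nsmul (S.filter (fun e => A e = j)) w 1 fun e _ => hw1 e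
    have h2 : ((#(S.filter (fun e => A e = j)) : ℕ) : ℝ) ≤ k + 1 := by exact_mod_cast hA j
    rw [nsmul_eq_mul, mul_one] at h
    exact h.trans h2
  · exact exists_packing_of_card_eq w hw1 n k hn S e₁ he₁ hwe₁ hc hT.le
  have hce := Finset.card_erase_add_one he₁
  obtain ⟨x, hx, hxmin'⟩ := Finset.exists_min_image (S.erase e₁) w
    (Finset.card_pos.mp (by omega))
  obtain ⟨hxe, hxS⟩ := Finset.mem_erase.mp hx
  have hxmin : ∀ e ∈ S, w x ≤ w e := fun e he => by
    by_cases h : e = e₁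
    · rw [h, hwe₁]; exact hw1 x
    · exact hxmin' e (Finset.mem_erase.mpr ⟨h, he⟩)
  have hsum := Finset.add_sum_erase S w hxS
  have hs0 := hw0 x hxS
  have hcx := Finset.card_erase_add_one hxS
  have he₁' : e₁ ∈ S.erase x := Finset.mem_erase.mpr ⟨hxe.symm, he₁⟩
  obtain ⟨A, hA⟩ := ih (S.erase x) (fun e he => hw0 e (Finset.mem_of_mem_erase he)) he₁'
    (by omega) (by
      have : (0 : ℝ) ≤ w x * (k + 2) := by positivity
      nlinarith)
  by_cases hfit : ∃ i, (∑ e ∈ S.erase x with A e = i, w e) + w x ≤ k + 1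
  · obtain ⟨i, hi⟩ := hfit
    refine ⟨Function.update A x i, fun j => ?_⟩
    have h := load_insert_update w (S.erase x) x (Finset.notMem_erase x S) A i j
    rw [Finset.insert_erase hxS] at h
    rw [h]
    split_ifs with hij
    · subst hij; exact hi
    · rw [add_zero]; exact hA j
  push Not at hfit
  have htot : ∑ j, ∑ e ∈ S.erase x with A e = j, w e = ∑ e ∈ S.erase x, w e :=
    Finset.sum_fiberwise _ _ _
  have hlow : ∀ j, (k : ℝ) + 1 - w x ≤ ∑ e ∈ S.erase x with A e = j, w e :=
    fun j => by linarith [hfit j]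
  have hbound := add_card_sub_one_mul_le_sum _ _ hlow
  rw [Fintype.card_fin, htot] at hbound
  have hload : ∀ j (c : ℕ), c ≤ #{e ∈ S.erase x | A e = j} →
      c * w x ≤ ∑ e ∈ S.erase x with A e = j, w e := fun j c hcj => by
    have h := Finset.card_nsmul_le_sum ((S.erase x).filter (fun e => A e = j)) w (w x)
      fun e he => hxmin e (Finset.mem_of_mem_erase (Finset.mem_of_mem_filter e he))
    rw [nsmul_eq_mul] at h
    have h2 : (c : ℝ) ≤ (#{e ∈ S.erase x | A e = j} : ℕ) := by exact_mod_cast hcj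
    exact (mul_le_mul_of_nonneg_right h2 hs0).trans h
  have hload₁ : ∀ c : ℕ, c + 1 ≤ #{e ∈ S.erase x | A e = A e₁} →
      1 + c * w x ≤ ∑ e ∈ S.erase x with A e = A e₁, w e := fun c hcj => by
    have hmem : e₁ ∈ (S.erase x).filter (fun e => A e = A e₁) := by
      simp [he₁, hxe.symm]
    have hcard := Finset.card_erase_add_one hmem
    have hs := Finset.add_sum_erase _ w hmem
    have h := Finset.card_nsmul_le_sum (((S.erase x).filter (fun e => A e = A e₁)).erase e₁)
      w (w x) fun e he => hxmin e (Finset.mem_of_mem_erase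
        (Finset.mem_of_mem_filter e (Finset.mem_of_mem_erase he)))
    rw [nsmul_eq_mul] at h
    have h2 : (c : ℝ) ≤
        (#(((S.erase x).filter (fun e => A e = A e₁)).erase e₁) : ℕ) := by
      exact_mod_cast (by omega)
    have := mul_le_mul_of_nonneg_right h2 hs0
    rw [hwe₁] at hs
    linarith
  have hn' : (2 : ℝ) ≤ n := by exact_mod_cast hn
  obtain ⟨i, hi⟩ : ∃ i, k + 2 ≤ #{e ∈ S.erase x | A e = i} := by
    by_contra! h
    have h1 := Finset.card_eq_sum_card_fiberwise (f := A) (s := S.erase x)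
      (t := Finset.univ) (fun e _ => by simp)
    have h2 := Finset.sum_le_card_nsmul Finset.univ
      (fun i => #{e ∈ S.erase x | A e = i}) (k + 1) fun j _ => Nat.lt_succ_iff.mp (h j)
    rw [smul_eq_mul, Finset.card_fin] at h2
    omega
  have hLi := hload i _ hi
  push_cast at hLi
  have hsle := hLi.trans (hA i)
  rcases Nat.eq_zero_or_pos k with rfl | hk
  · exfalso
    have h1 := hload₁ 0 (Finset.card_pos.mpr ⟨e₁, by simp [he₁, hxe.symm]⟩)
    have h2 := hbound (A e₁)
    norm_num at h1 h2 hT hsle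
    nlinarith [mul_nonneg (sub_nonneg.mpr hn') (sub_nonneg.mpr hsle)]
  have hk' : (1 : ℝ) ≤ k := by exact_mod_cast hk
  rcases hn.eq_or_lt with rfl | hn3
  · have hk2 : 2 ≤ k := by omega
    have hk2' : (2 : ℝ) ≤ k := by exact_mod_cast hk2
    push_cast at *
    have hskey : (k : ℝ) < (k + 2) * w x := by
      have h1 := hbound i
      have h2 := hlow i
      nlinarith
    by_cases hc4 : #S = 2 * (k + 2)
    · have hδ : ((k : ℝ) + 2) * (2 / (k + 2)) = 2 := by field_simp
      obtain ⟨X, hX, hD⟩ := exists_balanced_split w (2 / ((k : ℝ) + 2)) (by positivity) (k + 2)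
        S hc4 fun a _ b hb => by
          rw [le_div_iff₀ (by positivity)]
          nlinarith [hw1 a, hxmin b hb]
      have hXs := Finset.sum_sdiff (f := w) hX
      rw [abs_le] at hD
      have hmax : ∀ y, 2 * y ≤ (∑ e ∈ S, w e) + 2 / ((k : ℝ) + 2) → y ≤ k + 1 := fun y hy => by
        have h1 : ((k : ℝ) + 2) * (2 * y) ≤ (k + 2) * ((∑ e ∈ S, w e) + 2 / (k + 2)) :=
          mul_le_mul_of_nonneg_left hy (by positivity)
        by_contra! h
        nlinarith
      refine ⟨fun e => if e ∈ X then 0 else 1, fun j => ?_⟩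
      fin_cases j
      · have : S.filter (fun e => (if e ∈ X then (0 : Fin 2) else 1) = 0) = X := by
          ext e
          by_cases he : e ∈ X
          · simp [he, hX he]
          · simp [he]
        simp only [Fin.zero_eta, this]
        exact hmax _ (by linarith)
      · have : S.filter (fun e => (if e ∈ X then (0 : Fin 2) else 1) = 1) = S \ X := by
          ext e
          by_cases he : e ∈ X
          · simp [he]
          · simp [he]
        simp only [Fin.mk_one, this]
        exact hmax _ (by linarith)
    · exfalso
      by_cases hcase : k + 1 + 1 ≤ #{e ∈ S.erase x | A e = A e₁}
      · have h1 := hload₁ _ hcase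
        have h2 := hbound (A e₁)
        push_cast at h1
        nlinarith
      · obtain ⟨j, hj⟩ : ∃ j, k + 3 ≤ #{e ∈ S.erase x | A e = j} := by
          by_contra! h
          have h1 := Finset.card_eq_sum_card_fiberwise (f := A) (s := S.erase x)
            (t := Finset.univ) (fun e _ => by simp)
          rw [← Finset.add_sum_erase _ _ (Finset.mem_univ (A e₁))] at h1
          have h2 := Finset.sum_le_card_nsmul (Finset.univ.erase (A e₁))
            (fun i => #{e ∈ S.erase x | A e = i}) (k + 2) fun j _ => Nat.lt_succ_iff.mp (h j)
          simp at h2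
          omega
        have h1 := hload _ _ hj
        have h2 := hbound j
        push_cast at h1
        nlinarith
  · exfalso
    have hn3' : (3 : ℝ) ≤ n := by exact_mod_cast hn3
    have h1 := hbound i
    have h2 := hlow i
    obtain ⟨D, hD⟩ : ∃ D : ℝ, ((k : ℝ) + 2) * w x = k + 1 - D := ⟨k + 1 - (k + 2) * w x, by ring⟩
    have hD0 : 0 ≤ D := by linarith
    have hD1 : ((n : ℝ) - 1) * D < 1 := by
      have : n * ((k : ℝ) + 1 - w x) + w x ≤ ∑ e ∈ S, w e := by linarith
      have := mul_le_mul_of_nonneg_right this (by positivity : (0 : ℝ) ≤ k + 2)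
      have hid : (n * ((k : ℝ) + 1 - w x) + w x) * (k + 2) =
        n * (k + 1) * (k + 2) - (n - 1) * ((k + 2) * w x) := by ring
      rw [hid, hD] at this
      linarith
    have hD2 : (k : ℝ) < (k + 4 - n) * D := by
      have : ((n : ℝ) - 1) * (k + 1) + (k + 4 - n) * w x ≤ ∑ e ∈ S, w e := by linarith
      have := mul_le_mul_of_nonneg_right this (by positivity : (0 : ℝ) ≤ k + 2)
      have hid : (((n : ℝ) - 1) * (k + 1) + (k + 4 - n) * w x) * (k + 2) =
        (n - 1) * (k + 1) * (k + 2) + (k + 4 - n) * ((k + 2) * w x) := by ring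
      rw [hid, hD] at this
      linarith
    have hpos : (0 : ℝ) < k + 4 - n := by
      by_contra! h
      linarith [mul_nonpos_of_nonpos_of_nonneg h hD0]
    have h3 := mul_lt_mul_of_pos_left hD1 hpos
    have h4 := mul_lt_mul_of_pos_left hD2 (by linarith : (0 : ℝ) < n - 1)
    nlinarith

theorem stmt7 (n k : ℕ) (hn : 2 ≤ n) (hnk : ¬(n = 2 ∧ k = 1)) (α : ℝ)
    (hI1 : ((k:ℝ)+2)/((n:ℝ)*((k:ℝ)+1)^2 + (k:ℝ) + 2) < α)
    (hI2 : α ≤ 1/((k:ℝ)*(n:ℝ)+1))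
    (m : ℕ) (hm : ⌈1/α⌉ ≤ (m : ℤ)) (v : Fin m → ℝ) (hv : Vmem α m v) :
    MMS n m v ≤ ((k:ℝ)+1)*α := by
  obtain ⟨⟨hv0, hv1⟩, hsup⟩ := hv
  have hα : 0 < α := lt_of_le_of_lt (by positivity) hI1
  have : NeZero n := ⟨by omega⟩
  have : Nonempty (Fin m) := by
    by_contra h
    rw [not_nonempty_iff] at h
    simp at hv1
  obtain ⟨e₁, he₁⟩ := exists_eq_ciSup_of_finite (f := v)
  rw [hsup] at he₁
  have hle : ∀ e, v e ≤ α := fun e => hsup ▸ le_ciSup (Set.finite_range v).bddAbove e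
  rw [div_lt_iff₀ (by positivity)] at hI1
  obtain ⟨A, hA⟩ := exists_packing (fun e => v e / α) (fun e => (div_le_one hα).mpr (hle e)) n k
    hn hnk e₁ (by simp [he₁, hα.ne']) m Finset.univ (fun e _ => div_nonneg (hv0 e) hα.le)
    (Finset.mem_univ _) (by simp) (by
      rw [← Finset.sum_div, hv1, div_mul_eq_mul_div, one_mul, div_lt_iff₀ hα]
      linarith)
  refine (ciInf_le (Set.finite_range _).bddBelow A).trans (ciSup_le fun j => ?_)
  have h := hA j
  rwa [← Finset.sum_div, div_le_iff₀ hα] at h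
end

section
/- Let n ≥ 2 and k ≥ 0 be integers, not simultaneously n = 2 and k = 1, let α ∈ I(n,k), and let m ≥ ⌈1/α⌉. The disutility function v on m objects that assigns value α to ⌈1/α⌉ − 1 objects, value 1 − (⌈1/α⌉ − 1)α to one object, and value 0 to the remaining m − ⌈1/α⌉ objects belongs to V(α;m) and satisfies MMS_n(v) = (k+1)α. -/
open Finset

theorem MMS_le_mul_of_support_lt {n m q : ℕ} (hn : 0 < n) {a : ℝ} (ha : 0 ≤ a) {v : Fin m → ℝ}
    (hle : ∀ e, v e ≤ a) (hsupp : ∀ e : Fin m, n * q ≤ e → v e = 0) :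
    MMS n m v ≤ q * a := by
  have : Nonempty (Fin n) := ⟨⟨0, hn⟩⟩
  refine ciInf_le_of_le (Set.finite_range _).bddBelow
    (fun e => ⟨(e : ℕ) % n, Nat.mod_lt _ hn⟩) (ciSup_le fun j => ?_)
  set B : Finset (Fin m) :=
    univ.filter fun e => (⟨(e : ℕ) % n, Nat.mod_lt _ hn⟩ : Fin n) = j with hB
  have hcard : #(B.filter fun e : Fin m => (e : ℕ) < n * q) ≤ q := by
    rw [← card_range q]
    refine card_le_card_of_injOn (fun e => (e : ℕ) / n) (fun e he => ?_) fun e he e' he' h => ?_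
    · simp only [coe_filter, Set.mem_ofPred_eq] at he
      simpa using Nat.div_lt_of_lt_mul he.2
    · simp only [hB, coe_filter, Set.mem_ofPred_eq, mem_filter, mem_univ, true_and,
        Fin.ext_iff] at he he'
      ext
      rw [← Nat.div_add_mod (e : ℕ) n, ← Nat.div_add_mod (e' : ℕ) n, he.1, he'.1]
      exact congrArg (fun x => n * x + (j : ℕ)) h
  calc ∑ e ∈ B, v e = ∑ e ∈ B.filter (fun e : Fin m => (e : ℕ) < n * q), v e := by
        refine (sum_filter_of_ne fun e _ he => ?_).symm
        by_contra! h
        exact he (hsupp e h)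
    _ ≤ #(B.filter fun e : Fin m => (e : ℕ) < n * q) • a := sum_le_card_nsmul _ _ _ fun e _ => hle e
    _ ≤ q * a := by
        rw [nsmul_eq_mul]
        gcongr

theorem mul_le_MMS_of_lt_card {n m k : ℕ} (hn : 0 < n) {a : ℝ} (ha : 0 ≤ a) {v : Fin m → ℝ}
    (hv : ∀ e, 0 ≤ v e) {T : Finset (Fin m)} (hT : n * k < #T) (hTv : ∀ e ∈ T, a ≤ v e) :
    ((k : ℝ) + 1) * a ≤ MMS n m v := by
  have : Nonempty (Fin n) := ⟨⟨0, hn⟩⟩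
  refine le_ciInf fun A => ?_
  obtain ⟨j, -, hj⟩ := exists_lt_card_fiber_of_mul_lt_card_of_maps_to
    (s := T) (t := univ) (f := A) (fun _ _ => mem_univ _) (by simpa using hT)
  refine le_ciSup_of_le (Set.finite_range _).bddAbove j ?_
  calc ((k : ℝ) + 1) * a ≤ #(T.filter fun e => A e = j) • a := by
        rw [nsmul_eq_mul]
        gcongr
        exact_mod_cast hj
    _ ≤ ∑ e ∈ T.filter (fun e => A e = j), v e :=
        card_nsmul_le_sum _ _ _ fun e he => hTv e (mem_filter.1 he).1
    _ ≤ ∑ e ∈ univ.filter (fun e => A e = j), v e :=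
        sum_le_sum_of_subset_of_nonneg (filter_subset_filter _ (subset_univ _)) fun e _ _ => hv e

theorem stmt8 (n k : ℕ) (hn : 2 ≤ n) (hnk : ¬(n = 2 ∧ k = 1)) (α : ℝ)
    (hI1 : ((k:ℝ)+2)/((n:ℝ)*((k:ℝ)+1)^2 + (k:ℝ) + 2) < α)
    (hI2 : α ≤ 1/((k:ℝ)*(n:ℝ)+1))
    (m : ℕ) (hm : ⌈1/α⌉ ≤ (m : ℤ)) (v : Fin m → ℝ)
    (hvdef : ∀ e : Fin m, v e =
      if ((e:ℕ) : ℤ) < ⌈1/α⌉ - 1 then α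
      else if ((e:ℕ) : ℤ) = ⌈1/α⌉ - 1 then 1 - ((⌈1/α⌉ : ℝ) - 1)*α
      else 0) :
    Vmem α m v ∧ MMS n m v = ((k:ℝ)+1)*α := by
  have hα : 0 < α := lt_trans (by positivity) hI1
  obtain ⟨p, hp⟩ : ∃ p : ℕ, ⌈1 / α⌉ = (p : ℤ) + 1 := by
    have : 0 < ⌈1 / α⌉ := Int.ceil_pos.2 (by positivity)
    exact ⟨(⌈1 / α⌉ - 1).toNat, by omega⟩
  have hn' : (2 : ℝ) ≤ n := by exact_mod_cast hn
  obtain ⟨hlo, hhi⟩ := Int.ceil_eq_iff.1 hp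
  push_cast at hlo hhi
  rw [add_sub_cancel_right, lt_div_iff₀ hα] at hlo
  rw [div_le_iff₀ hα] at hhi
  rw [le_div_iff₀ (by positivity)] at hI2
  rw [div_lt_iff₀ (by positivity)] at hI1
  have hv : ∀ e : Fin m, v e =
      if (e : ℕ) < p then α else if (e : ℕ) = p then 1 - p * α else 0 := fun e => by
    rw [hvdef, hp]
    simp
  have hpm : p + 1 ≤ m := by omega
  have hkp : n * k ≤ p := by
    have : (k * n : ℝ) < p + 1 := by nlinarith
    have : k * n < p + 1 := by exact_mod_cast this
    linarith
  have hpk : p < n * (k + 1) := by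
    have h : (p : ℝ) * (k + 2) < n * (k + 1) ^ 2 + (k + 2) := by
      nlinarith
    have h' : (p : ℝ) < n * (k + 1) := by
      by_contra! hc
      nlinarith [mul_le_mul_of_nonneg_right hc (by positivity : (0 : ℝ) ≤ k + 2),
        mul_le_mul_of_nonneg_right hn' (by positivity : (0 : ℝ) ≤ k + 1)]
    exact_mod_cast h'
  have hnonneg : ∀ e, 0 ≤ v e := fun e => by
    rw [hv]
    split_ifs <;> linarith
  have hle : ∀ e, v e ≤ α := fun e => by
    rw [hv]
    split_ifs <;> linarith
  have hlarge : ∀ e : Fin m, (e : ℕ) < n * k + 1 → v e = α := fun e he => by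
    rw [hv]
    split_ifs with h₁ h₂
    · rfl
    · have hpe : p = n * k := by omega
      rw [hpe] at hhi ⊢
      push_cast at hhi ⊢
      linarith
    · omega
  have hsum : ∑ e, v e = 1 := by
    simp_rw [hv]
    rw [Fin.sum_univ_eq_sum_range
        (fun i => if i < p then α else if i = p then 1 - p * α else 0) m,
      ← sum_subset (range_mono hpm), sum_range_succ,
      sum_congr rfl fun i hi => if_pos (mem_range.1 hi)]
    · simp
    · intro i _ hi
      rw [mem_range] at hi
      rw [if_neg (by omega), if_neg (by omega)]
  have hnpos : 0 < n := by omega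
  refine ⟨⟨⟨hnonneg, hsum⟩, ?_⟩, le_antisymm ?_ ?_⟩
  · have : Nonempty (Fin m) := ⟨⟨0, by omega⟩⟩
    exact le_antisymm (ciSup_le hle)
      (le_ciSup_of_le (Set.finite_range _).bddAbove ⟨0, by omega⟩ (hlarge _ (by simp)).ge)
  · have := MMS_le_mul_of_support_lt (q := k + 1) hnpos hα.le hle fun e he => by
      rw [hv, if_neg (by omega), if_neg (by omega)]
    exact_mod_cast this
  · refine mul_le_MMS_of_lt_card hnpos hα.le hnonneg
      (T := univ.map (Fin.castLEEmb (by omega : n * k + 1 ≤ m))) (by simp) fun e he => ?_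
    obtain ⟨i, -, rfl⟩ := mem_map.1 he
    exact (hlarge _ i.isLt).ge
end

section
/- For n = 2 agents and every integer m ≥ 6: (i) for every real α with 1/5 < α ≤ 7/27, every v ∈ V(α; m) satisfies MMS_2(v) ≤ (3 − 3α)/4 and there exists v ∈ V(α; m) with MMS_2(v) = (3 − 3α)/4; (ii) for every α with 7/27 < α ≤ 2/7, every v ∈ V(α; m) satisfies MMS_2(v) ≤ α + (2 − 2α)/5 and there exists v ∈ V(α; m) with MMS_2(v) = α + (2 − 2α)/5; (iii) for every α with 2/7 < α ≤ 1/3, every v ∈ V(α; m) satisfies MMS_2(v) ≤ 2α and there exists v ∈ V(α; m) with MMS_2(v) = 2α. -/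
open Finset

/-- The `MinMaxShare` is at most the largest bundle of any split into `S` and its complement. -/
lemma MMS_two_le {m : ℕ} {v : Fin m → ℝ} {T : ℝ} (S : Finset (Fin m))
    (hS : ∑ e ∈ S, v e ≤ T) (hS' : ∑ e, v e - ∑ e ∈ S, v e ≤ T) : MMS 2 m v ≤ T := by
  refine (ciInf_le (Set.finite_range _).bddBelow (fun e => if e ∈ S then 0 else 1)).trans ?_
  have h0 : univ.filter (fun e => (if e ∈ S then (0 : Fin 2) else 1) = 0) = S := by
    ext e; by_cases h : e ∈ S <;> simp [h]
  have h1 : univ.filter (fun e => (if e ∈ S then (0 : Fin 2) else 1) = 1) = Sᶜ := by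
    ext e; by_cases h : e ∈ S <;> simp [h]
  refine ciSup_le fun j => ?_
  fin_cases j
  · simpa only [Fin.zero_eta, h0] using hS
  · have := Finset.sum_add_sum_compl S v
    simp only [Fin.mk_one, h1]
    linarith

/-- If no subset sum lies in `[1 - T, T]`, then adding objects of value at most `2T - 1` to a set
of value at most `T` keeps it below `1 - T`. -/
lemma sum_add_sum_lt_of_small {ι : Type*} [DecidableEq ι] {v : ι → ℝ} {T : ℝ}
    (gap : ∀ S : Finset ι, T < ∑ e ∈ S, v e ∨ ∑ e ∈ S, v e < 1 - T)
    {X R : Finset ι} (hXR : Disjoint X R) (hR : ∀ e ∈ R, v e ≤ 2 * T - 1)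
    (hX : ∑ e ∈ X, v e ≤ T) : ∑ e ∈ X, v e + ∑ e ∈ R, v e < 1 - T := by
  induction R using Finset.induction_on with
  | empty =>
    rcases gap X with h | h
    · exact absurd hX (not_le.2 h)
    · simpa using h
  | insert a R ha ih =>
    rw [Finset.disjoint_insert_right] at hXR
    have h := ih hXR.2 fun e he => hR e (Finset.mem_insert_of_mem he)
    have hd : Disjoint X (insert a R) := Finset.disjoint_insert_right.2 hXR
    have ha' := hR a (Finset.mem_insert_self a R)
    rcases gap (X ∪ insert a R) with h' | h' <;>
      rw [Finset.sum_union hd, Finset.sum_insert ha] at h' <;>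
      rw [Finset.sum_insert ha] <;> linarith

/-- If exchanging two elements cannot cross the gap, a triple above the gap forces the
neighbouring triples above it. -/
lemma above_gap_of_exchange {a T σ x y z : ℝ} (hσ : 0 ≤ σ) (hswap : 3 - a ≤ 5 * T)
    (hx : x < 1 - T - a - σ) (hz : 2 * T - 1 < z) (h : T < a + x + y)
    (hyz : T < a + y + z ∨ a + y + z + σ < 1 - T) : T < a + y + z := by
  rcases hyz with h' | h' <;> linarith

lemma no_gap_five {a T σ : ℝ} (hσ : 0 ≤ σ) (hswap : 3 - a ≤ 5 * T) (hhigh : 2 + 3 * a ≤ 5 * T)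
    (b : Fin 5 → ℝ) (hsum : a + ∑ i, b i + σ = 1) (hba : ∀ i, b i ≤ a)
    (hlow : ∀ i, b i < 1 - T - a - σ) (hbig : ∀ i, 2 * T - 1 < b i)
    (hpair : ∀ i j, i ≠ j → T < a + b i + b j ∨ a + b i + b j + σ < 1 - T) : False := by
  have step : ∀ i j k, j ≠ k → T < a + b i + b j → T < a + b j + b k := fun i j k hjk h =>
    above_gap_of_exchange hσ hswap (hlow i) (hbig k) h (hpair j k hjk)
  simp only [Fin.sum_univ_five] at hsum
  have h01 : T < a + b 0 + b 1 := by
    rcases hpair 0 1 (by decide) with h | h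
    · exact h
    · have h23 : T < a + b 2 + b 3 := by linarith [hba 4]
      have h30 := step _ _ 0 (by decide) h23
      exact step _ _ _ (by decide) (by linarith : T < a + b 3 + b 0)
  have h12 := step _ _ 2 (by decide) h01
  have h23 := step _ _ 3 (by decide) h12
  have h34 := step _ _ 4 (by decide) h23
  have h40 := step _ _ 0 (by decide) h34
  linarith

lemma no_gap_six {a T σ : ℝ} (hσ : 0 ≤ σ) (hswap : 3 - a ≤ 5 * T) (hhigh : 1 + 2 * a ≤ 3 * T)
    (hlow' : 2 * (1 - a) ≤ 3 * T)
    (b : Fin 6 → ℝ) (hsum : a + ∑ i, b i + σ = 1)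
    (hlow : ∀ i, b i < 1 - T - a - σ) (hbig : ∀ i, 2 * T - 1 < b i)
    (hpair : ∀ i j, i ≠ j → T < a + b i + b j ∨ a + b i + b j + σ < 1 - T) : False := by
  have step : ∀ i j k, j ≠ k → T < a + b i + b j → T < a + b j + b k := fun i j k hjk h =>
    above_gap_of_exchange hσ hswap (hlow i) (hbig k) h (hpair j k hjk)
  simp only [Fin.sum_univ_six] at hsum
  have all : ∀ i j : Fin 6, i ≠ j → T < a + b i + b j → False := by
    have h01 : ¬ T < a + b 0 + b 1 := fun h01 => by
      have h12 := step _ _ 2 (by decide) h01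
      have h23 := step _ _ 3 (by decide) h12
      have h34 := step _ _ 4 (by decide) h23
      have h45 := step _ _ 5 (by decide) h34
      linarith
    intro i j hij h
    by_cases hj : j = 0
    · subst hj; exact h01 (step _ _ _ (by decide) h)
    · have h0 := step _ _ 0 hj h
      exact h01 (step _ _ _ (by decide) h0)
  have h01 := (hpair 0 1 (by decide)).resolve_left (all _ _ (by decide))
  have h23 := (hpair 2 3 (by decide)).resolve_left (all _ _ (by decide))
  have h45 := (hpair 4 5 (by decide)).resolve_left (all _ _ (by decide))
  linarith

lemma MMS_two_le_of_Vmem {m : ℕ} {v : Fin m → ℝ} {a T : ℝ} (hv : Vmem a m v)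
    (ha : 0 < a) (hpairs : 2 * a ≤ T) (hfour : 3 - 3 * a ≤ 4 * T)
    (hswap : 3 - a ≤ 5 * T) (hfive : 2 + 3 * a ≤ 5 * T) (hsix : 1 + 2 * a ≤ 3 * T)
    (hsix' : 2 * (1 - a) ≤ 3 * T) (hseven : 8 - a < 14 * T) : MMS 2 m v ≤ T := by
  classical
  obtain ⟨⟨hnn, hsum⟩, hmax⟩ := hv
  by_contra hMMS
  have gap : ∀ S : Finset (Fin m), T < ∑ e ∈ S, v e ∨ ∑ e ∈ S, v e < 1 - T := by
    intro S
    by_contra! h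
    exact hMMS (MMS_two_le S h.1 (by linarith [h.2]))
  have hle : ∀ e, v e ≤ a := fun e => hmax ▸ le_ciSup (Set.finite_range v).bddAbove e
  have : Nonempty (Fin m) := by
    by_contra h
    rw [not_nonempty_iff] at h
    simp at hsum
  obtain ⟨e₀, he₀⟩ := exists_eq_ciSup_of_finite (f := v)
  rw [hmax] at he₀
  set B := (univ.erase e₀).filter (fun e => 2 * T - 1 < v e) with hB
  set R := (univ.erase e₀).filter (fun e => ¬ 2 * T - 1 < v e) with hR
  set σ := ∑ e ∈ R, v e with hσdef
  have hσ : 0 ≤ σ := Finset.sum_nonneg fun e _ => hnn e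
  have htot : a + ∑ e ∈ B, v e + σ = 1 := by
    have h1 := Finset.sum_filter_add_sum_filter_not (univ.erase e₀) (fun e => 2 * T - 1 < v e) v
    have h2 := Finset.add_sum_erase univ v (Finset.mem_univ e₀)
    linarith
  have he₀B : e₀ ∉ B := by simp [hB]
  have he₀R : e₀ ∉ R := by simp [hR]
  have hBR : ∀ e ∈ B, e ∉ R := by simp +contextual [hB, hR]
  have hbig : ∀ e ∈ B, 2 * T - 1 < v e := fun e he => (Finset.mem_filter.1 he).2
  have fill : ∀ X : Finset (Fin m), Disjoint X R → ∑ e ∈ X, v e ≤ T →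
      ∑ e ∈ X, v e + σ < 1 - T := fun X hX h =>
    sum_add_sum_lt_of_small gap hX (fun e he => not_lt.1 (Finset.mem_filter.1 he).2) h
  have hsingle : a + σ < 1 - T := by
    have := fill {e₀} (by simpa using he₀R) (by simp only [Finset.sum_singleton]; linarith)
    simpa [he₀] using this
  have hlow : ∀ e ∈ B, v e < 1 - T - a - σ := by
    intro e he
    have hne : e₀ ≠ e := fun h => he₀B (h ▸ he)
    have := fill {e₀, e} (by simp [he₀R, hBR e he])
      (by rw [Finset.sum_pair hne]; linarith [hle e])
    rw [Finset.sum_pair hne] at this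
    linarith
  have hpair : ∀ x ∈ B, ∀ y ∈ B, x ≠ y →
      T < a + v x + v y ∨ a + v x + v y + σ < 1 - T := by
    intro x hx y hy hxy
    have hs : ∑ e ∈ ({e₀, x, y} : Finset (Fin m)), v e = a + v x + v y := by
      rw [Finset.sum_insert, Finset.sum_pair hxy, he₀, add_assoc]
      simp only [Finset.mem_insert, Finset.mem_singleton, not_or]
      exact ⟨fun h => he₀B (h ▸ hx), fun h => he₀B (h ▸ hy)⟩
    rcases lt_or_ge T (a + v x + v y) with h | h
    · exact Or.inl h
    · right
      rw [← hs] at h ⊢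
      exact fill _ (by simp [he₀R, hBR x hx, hBR y hy]) h
  have enum : ∀ k, B.card = k → ∃ b : Fin k → Fin m, Function.Injective b ∧ (∀ i, b i ∈ B) ∧
      ∑ i, v (b i) = ∑ e ∈ B, v e := by
    intro k hk
    let f := B.equivFinOfCardEq hk
    refine ⟨fun i => f.symm i, fun i j h => f.symm.injective (Subtype.ext h),
      fun i => (f.symm i).2, ?_⟩
    rw [Equiv.sum_comp f.symm (fun e : B => v e), Finset.sum_coe_sort B v]
  rcases lt_or_ge B.card 5 with hc | hc
  · rcases B.eq_empty_or_nonempty with h | h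
    · rw [h, Finset.sum_empty] at htot
      linarith
    · have h1 : ∑ e ∈ B, v e < ∑ _e ∈ B, (1 - T - a - σ) := Finset.sum_lt_sum_of_nonempty h hlow
      rw [Finset.sum_const, nsmul_eq_mul] at h1
      have h2 : (B.card : ℝ) ≤ 4 := by exact_mod_cast Nat.lt_succ_iff.1 hc
      have h3 := mul_le_mul_of_nonneg_right h2 (by linarith : 0 ≤ 1 - T - a - σ)
      linarith
  rcases lt_or_ge B.card 7 with hc' | hc'
  · obtain hk | hk : B.card = 5 ∨ B.card = 6 := by omega
    · obtain ⟨b, hb, hbB, hbs⟩ := enum 5 hk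
      exact no_gap_five hσ hswap hfive (fun i => v (b i)) (by rw [hbs]; exact htot)
        (fun i => hle _) (fun i => hlow _ (hbB i)) (fun i => hbig _ (hbB i))
        (fun i j hij => hpair _ (hbB i) _ (hbB j) (hb.ne hij))
    · obtain ⟨b, hb, hbB, hbs⟩ := enum 6 hk
      exact no_gap_six hσ hswap hsix hsix' (fun i => v (b i)) (by rw [hbs]; exact htot)
        (fun i => hlow _ (hbB i)) (fun i => hbig _ (hbB i))
        (fun i j hij => hpair _ (hbB i) _ (hbB j) (hb.ne hij))
  · have h1 : B.card • (2 * T - 1) ≤ ∑ e ∈ B, v e :=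
      Finset.card_nsmul_le_sum _ _ _ fun e he => (hbig e he).le
    rw [nsmul_eq_mul] at h1
    have h2 : (7 : ℝ) ≤ B.card := by exact_mod_cast hc'
    have h3 := mul_le_mul_of_nonneg_right h2 (by linarith : 0 ≤ 2 * T - 1)
    linarith

/-- A disutility function on six objects all of whose splits have a bundle of value at least `T`
extends by zero to any larger set of objects. -/
lemma exists_Vmem_MMS_eq {m : ℕ} (hm : 6 ≤ m) {a T : ℝ} (ha : 0 ≤ a) (w : Fin 6 → ℝ)
    (hw : ∀ i, 0 ≤ w i) (hsum : ∑ i, w i = 1) (hle : ∀ i, w i ≤ a) (h0 : w 0 = a)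
    (hsplit : ∀ p : Fin 6 → Fin 2, ∃ j, T ≤ ∑ i, if p i = j then w i else 0)
    (hT : ∀ v : Fin m → ℝ, Vmem a m v → MMS 2 m v ≤ T) :
    ∃ v : Fin m → ℝ, Vmem a m v ∧ MMS 2 m v = T := by
  obtain ⟨k, rfl⟩ := Nat.exists_eq_add_of_le hm
  have hV : Vmem a (6 + k) (Fin.append w 0) := by
    refine ⟨⟨fun e => ?_, ?_⟩, le_antisymm (ciSup_le fun e => ?_) ?_⟩
    · refine Fin.addCases (fun i => ?_) (fun i => ?_) e
      · simpa using hw i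
      · simp
    · simp [Fin.sum_univ_add, hsum]
    · refine Fin.addCases (fun i => ?_) (fun i => ?_) e
      · simpa using hle i
      · simpa using ha
    · have := le_ciSup (Set.finite_range (Fin.append w (0 : Fin k → ℝ))).bddAbove
        (Fin.castAdd k 0)
      rwa [Fin.append_left, h0] at this
  refine ⟨_, hV, le_antisymm (hT _ hV) (le_ciInf fun A => ?_)⟩
  obtain ⟨j, hj⟩ := hsplit fun i => A (Fin.castAdd k i)
  refine hj.trans (le_trans (le_of_eq ?_) (le_ciSup (Set.finite_range _).bddAbove j))
  simp [Finset.sum_filter, Fin.sum_univ_add]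

/-- To bound every two-bundle split from below it suffices to consider the bundle containing
object `0` and its complement. -/
lemma exists_bundle_ge {w : Fin 6 → ℝ} {T : ℝ}
    (h : ∀ c : Fin 6 → Bool, c 0 = true → ∑ i, (if c i then w i else 0) < T →
      ∑ i, (if c i then 0 else w i) < T → False) (p : Fin 6 → Fin 2) :
    ∃ j, T ≤ ∑ i, if p i = j then w i else 0 := by
  by_contra! hlt
  have hne : ∀ i, p i ≠ p 0 ↔ p i = 1 - p 0 := fun i => by
    generalize p i = x; generalize p 0 = y; revert x y; decide
  refine h (fun i => decide (p i = p 0)) (by simp) (by simpa using hlt (p 0)) ?_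
  refine lt_of_eq_of_lt (Finset.sum_congr rfl fun i _ => ?_) (hlt (1 - p 0))
  simp only [← hne i, decide_eq_true_eq, ite_not, ne_eq]

theorem stmt11 (m : ℕ) (hm : 6 ≤ m) :
    (∀ α : ℝ, 1/5 < α → α ≤ 7/27 →
      (∀ v : Fin m → ℝ, Vmem α m v → MMS 2 m v ≤ (3 - 3*α)/4) ∧
      (∃ v : Fin m → ℝ, Vmem α m v ∧ MMS 2 m v = (3 - 3*α)/4)) ∧
    (∀ α : ℝ, 7/27 < α → α ≤ 2/7 →
      (∀ v : Fin m → ℝ, Vmem α m v → MMS 2 m v ≤ α + (2 - 2*α)/5) ∧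
      (∃ v : Fin m → ℝ, Vmem α m v ∧ MMS 2 m v = α + (2 - 2*α)/5)) ∧
    (∀ α : ℝ, 2/7 < α → α ≤ 1/3 →
      (∀ v : Fin m → ℝ, Vmem α m v → MMS 2 m v ≤ 2*α) ∧
      (∃ v : Fin m → ℝ, Vmem α m v ∧ MMS 2 m v = 2*α)) := by
  refine ⟨?_, ?_, ?_⟩
  · intro α h₁ h₂
    have hup : ∀ v : Fin m → ℝ, Vmem α m v → MMS 2 m v ≤ (3 - 3*α)/4 := fun v hv => by
      apply MMS_two_le_of_Vmem hv <;> linarith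
    refine ⟨hup, exists_Vmem_MMS_eq hm (by linarith)
      ![α, (1 - α) / 4, (1 - α) / 4, (1 - α) / 4, (1 - α) / 4, 0]
      (fun i => ?_) ?_ (fun i => ?_) rfl (exists_bundle_ge fun c hc => ?_) hup⟩
    · fin_cases i <;> simp <;> linarith
    · simp [Fin.sum_univ_six]; ring
    · fin_cases i <;> simp <;> linarith
    · simp only [Fin.sum_univ_six, hc]
      rcases c 1 <;> rcases c 2 <;> rcases c 3 <;> rcases c 4 <;> rcases c 5 <;>
        simp <;> intros <;> linarith
  · intro α h₁ h₂
    have hup : ∀ v : Fin m → ℝ, Vmem α m v → MMS 2 m v ≤ α + (2 - 2*α)/5 := fun v hv => by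
      apply MMS_two_le_of_Vmem hv <;> linarith
    refine ⟨hup, exists_Vmem_MMS_eq hm (by linarith)
      ![α, (1 - α) / 5, (1 - α) / 5, (1 - α) / 5, (1 - α) / 5, (1 - α) / 5]
      (fun i => ?_) ?_ (fun i => ?_) rfl (exists_bundle_ge fun c hc => ?_) hup⟩
    · fin_cases i <;> simp <;> linarith
    · simp [Fin.sum_univ_six]; ring
    · fin_cases i <;> simp <;> linarith
    · simp only [Fin.sum_univ_six, hc]
      rcases c 1 <;> rcases c 2 <;> rcases c 3 <;> rcases c 4 <;> rcases c 5 <;>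
        simp <;> intros <;> linarith
  · intro α h₁ h₂
    have hup : ∀ v : Fin m → ℝ, Vmem α m v → MMS 2 m v ≤ 2*α := fun v hv => by
      apply MMS_two_le_of_Vmem hv <;> linarith
    refine ⟨hup, exists_Vmem_MMS_eq hm (by linarith)
      ![α, α, α, 1 - 3 * α, 0, 0]
      (fun i => ?_) ?_ (fun i => ?_) rfl (exists_bundle_ge fun c hc => ?_) hup⟩
    · fin_cases i <;> simp <;> linarith
    · simp [Fin.sum_univ_six]; ring
    · fin_cases i <;> simp <;> linarith
    · simp only [Fin.sum_univ_six, hc]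
      rcases c 1 <;> rcases c 2 <;> rcases c 3 <;> rcases c 4 <;> rcases c 5 <;>
        simp <;> intros <;> linarith
end
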